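/- arXiv:1805.07668 — 2 statements merged into one kernel-verified Lean document; each statement's English description precedes it below -/
import Mathlib

section
/- Let f ∈ K(z) be a rational function of degree d > 1 having no potentially good reductions, let a ∈ P^1(K) \ E(f), and let D be a non-empty open subset of P^1(K). Then lim_{n→∞} (sup_{w∈D} log [f^n(w), a]_{P^1}) / d^n = 0, where f^n denotes the n-th iterate of f. -/
open scoped Classical

open Polynomial Filter MeasureTheory Topology

variable (K : Type*) [NontriviallyNormedField K] [IsAlgClosed K] [CompleteSpace K]
  [IsUltrametricDist K]

/-- The degree of a rational function: max of degrees of numerator and denominator. -/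
noncomputable def rdeg (h : RatFunc K) : ℕ := max h.num.natDegree h.denom.natDegree

/-- Canonical homogeneous coordinates of a point of `P^1(K) = K ∪ {∞}`. -/
noncomputable def homCoord : OnePoint K → K × K :=
  OnePoint.rec (1, 0) (fun a => (a, 1))

/-- The (normalized) chordal metric on `P^1(K)`:
`[z,w] = |z0*w1 - z1*w0| / (max(|z0|,|z1|) * max(|w0|,|w1|))`. -/
noncomputable def chordal (x y : OnePoint K) : ℝ :=
  ‖(homCoord K x).1 * (homCoord K y).2 - (homCoord K x).2 * (homCoord K y).1‖ /
    (max ‖(homCoord K x).1‖ ‖(homCoord K x).2‖ * max ‖(homCoord K y).1‖ ‖(homCoord K y).2‖)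

/-- The action of a rational function on the projective line `P^1(K) = K ∪ {∞}`. -/
noncomputable def evalP1 (h : RatFunc K) : OnePoint K → OnePoint K :=
  OnePoint.rec
    (if h.denom.natDegree < h.num.natDegree then OnePoint.infty
      else ((h.num.coeff h.denom.natDegree / h.denom.leadingCoeff : K) : OnePoint K))
    (fun a => if h.denom.eval a = 0 then OnePoint.infty
      else ((h.num.eval a / h.denom.eval a : K) : OnePoint K))

/-- Composition of rational functions. -/
noncomputable def rcomp (f g : RatFunc K) : RatFunc K :=
  RatFunc.eval (algebraMap K (RatFunc K)) g f

/-- Iterates of a rational function, as rational functions. -/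
noncomputable def riter (f : RatFunc K) : ℕ → RatFunc K
  | 0 => RatFunc.X
  | n + 1 => rcomp K f (riter f n)

/-- The ring of `K`-integers. -/
noncomputable def intRing : Subring K where
  carrier := {x : K | ‖x‖ ≤ 1}
  mul_mem' := by
    intro a b ha hb
    simp only [Set.mem_setOf_eq, norm_mul] at *
    exact mul_le_one₀ ha (norm_nonneg _) hb
  one_mem' := by simp
  add_mem' := by
    intro a b ha hb
    exact le_trans (IsUltrametricDist.norm_add_le_max a b) (max_le ha hb)
  zero_mem' := by simp
  neg_mem' := by
    intro a ha
    simpa using ha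

/-- The maximal ideal `m_K = {x : ‖x‖ < 1}` of the ring of `K`-integers. -/
noncomputable def maxIdeal : Ideal (intRing K) where
  carrier := {x | ‖(x : K)‖ < 1}
  add_mem' := by
    intro a b ha hb
    exact lt_of_le_of_lt (IsUltrametricDist.norm_add_le_max (a : K) (b : K)) (max_lt ha hb)
  zero_mem' := by simp
  smul_mem' := by
    intro c x hx
    simp only [Set.mem_setOf_eq, smul_eq_mul, Subring.coe_mul, norm_mul] at *
    calc ‖(c : K)‖ * ‖(x : K)‖ ≤ 1 * ‖(x : K)‖ :=
          mul_le_mul_of_nonneg_right c.2 (norm_nonneg _)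
      _ = ‖(x : K)‖ := one_mul _
      _ < 1 := hx

/-- The residue field `k = O_K / m_K` (as a quotient ring). -/
noncomputable abbrev residueRing := intRing K ⧸ maxIdeal K

/-- A polynomial with `K`-integral coefficients, viewed as a polynomial over `K`. -/
noncomputable def toK : Polynomial (intRing K) → Polynomial K :=
  Polynomial.map (intRing K).subtype

/-- Reduction of a polynomial with `K`-integral coefficients modulo the maximal ideal. -/
noncomputable def redPoly : Polynomial (intRing K) → Polynomial (residueRing K) :=
  Polynomial.map (Ideal.Quotient.mk (maxIdeal K))

/-- `(P, Q)` is a normalized (non-degenerate homogeneous) lift of the rational function `h`: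
all coefficients are `K`-integers, at least one coefficient has absolute value `1`,
`h = P/Q`, `P` and `Q` are coprime, and `max (deg P) (deg Q) = deg h`. -/
def IsNormalizedLift (h : RatFunc K) (P Q : Polynomial (intRing K)) : Prop :=
  toK K Q ≠ 0 ∧ IsCoprime (toK K P) (toK K Q) ∧
    max (toK K P).natDegree (toK K Q).natDegree = rdeg K h ∧
    h * algebraMap (Polynomial K) (RatFunc K) (toK K Q) =
      algebraMap (Polynomial K) (RatFunc K) (toK K P) ∧
    ∃ i : ℕ, ‖(P.coeff i : K)‖ = 1 ∨ ‖(Q.coeff i : K)‖ = 1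

/-- The reduction modulo `m_K` of the (normalized lift `(P,Q)` of a) rational function of
degree `d` has degree `< d`: after reducing the pair of coefficients, either the reduced
pair has a common factor, or both reduced degrees drop (a common factor at infinity). -/
def ReductionDegreeDrops (P Q : Polynomial (intRing K)) (d : ℕ) : Prop :=
  ¬ IsCoprime (redPoly K P) (redPoly K Q) ∨
    ((redPoly K P).natDegree < d ∧ (redPoly K Q).natDegree < d)

/-- `f` has no potentially good reductions: for every Möbius conjugation
`φ ∘ f ∘ φ⁻¹` of `f`, the degree of the reduction modulo `m_K` drops below `deg f`. -/
def NoPotentiallyGoodReductions (f : RatFunc K) : Prop :=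
  ∀ φ ψ : RatFunc K, rdeg K φ = 1 → rdeg K ψ = 1 → rcomp K φ ψ = RatFunc.X →
    ∀ P Q : Polynomial (intRing K),
      IsNormalizedLift K (rcomp K (rcomp K φ f) ψ) P Q →
        ReductionDegreeDrops K P Q (rdeg K f)

/-- The exceptional set `E(f) = {a : ⋃_{n ≥ 0} f⁻ⁿ(a) is finite}`. -/
def exceptionalSet (f : RatFunc K) : Set (OnePoint K) :=
  {a | Set.Finite {b : OnePoint K | ∃ n : ℕ, (evalP1 K f)^[n] b = a}}

section Abstract

variable {K}

set_option linter.unusedSectionVars false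

lemma ultra_sub (x y : K) : ‖x - y‖ ≤ max ‖x‖ ‖y‖ := by
  have h := IsUltrametricDist.norm_add_le_max x (-y)
  rwa [norm_neg, ← sub_eq_add_neg] at h

/-- The wedge product on `K²`. -/
def wdg (Z X : K × K) : K := Z.1 * X.2 - Z.2 * X.1

lemma wdg_self (Z : K × K) : wdg Z Z = 0 := by simp [wdg, mul_comm]

lemma wdg_swap (Z X : K × K) : wdg Z X = - wdg X Z := by simp [wdg]; ring

lemma wdg_comm_zero {Z X : K × K} (h : wdg Z X = 0) : wdg X Z = 0 := by
  rw [wdg_swap, h, neg_zero]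

lemma norm_wdg_le (Z X : K × K) : ‖wdg Z X‖ ≤ ‖Z‖ * ‖X‖ := by
  have h := ultra_sub (Z.1 * X.2) (Z.2 * X.1)
  refine h.trans (max_le ?_ ?_)
  · rw [norm_mul]
    exact mul_le_mul (norm_fst_le Z) (norm_snd_le X) (norm_nonneg _) (norm_nonneg _)
  · rw [norm_mul]
    exact mul_le_mul (norm_snd_le Z) (norm_fst_le X) (norm_nonneg _) (norm_nonneg _)

lemma wdg_indep (Z X Y : K × K) :
    ‖wdg X Y‖ * ‖Z‖ ≤ max (‖wdg Z X‖ * ‖Y‖) (‖wdg Z Y‖ * ‖X‖) := by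
  have key : (wdg X Y) • Z = (wdg Z Y) • X - (wdg Z X) • Y := by
    ext <;> simp [wdg] <;> ring
  rw [← norm_smul, key, ← norm_smul, ← norm_smul, max_comm]
  rw [Prod.norm_def]
  have h1 := ultra_sub ((wdg Z Y) • X).1 ((wdg Z X) • Y).1
  have h2 := ultra_sub ((wdg Z Y) • X).2 ((wdg Z X) • Y).2
  refine max_le (h1.trans ?_) (h2.trans ?_)
  · exact max_le_max (norm_fst_le _) (norm_fst_le _)
  · exact max_le_max (norm_snd_le _) (norm_snd_le _)

lemma wdg_trans {X Y Z : K × K} (hY : Y ≠ 0) (h1 : wdg X Y = 0) (h2 : wdg Y Z = 0) :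
    wdg X Z = 0 := by
  have h := wdg_indep Y X Z
  rw [wdg_comm_zero h1, h2] at h
  simp only [norm_zero, zero_mul, max_self] at h
  have h3 : 0 < ‖Y‖ := norm_pos_iff.2 hY
  have h4 : ‖wdg X Z‖ ≤ 0 := by
    by_contra hc
    push Not at hc
    have := mul_pos hc h3
    linarith
  simpa using h4

/-- uniform constant over a finite set -/
lemma unif_pos {α : Type*} (s : Finset α) (P : α → ℝ → Prop)
    (hmono : ∀ x δ δ', 0 < δ' → δ' ≤ δ → P x δ → P x δ')
    (h : ∀ x ∈ s, ∃ δ > 0, P x δ) : ∃ δ > 0, δ ≤ 1 ∧ ∀ x ∈ s, P x δ := by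
  induction s using Finset.induction_on with
  | empty => exact ⟨1, one_pos, le_rfl, by simp⟩
  | insert x s hx ih =>
    obtain ⟨δ, h0, h1, h2⟩ := ih (fun y hy => h y (Finset.mem_insert_of_mem hy))
    obtain ⟨δ', h0', h2'⟩ := h x (Finset.mem_insert_self _ _)
    have hm : 0 < min δ δ' := lt_min h0 h0'
    refine ⟨min δ δ', hm, (min_le_left _ _).trans h1, ?_⟩
    intro y hy
    rcases Finset.mem_insert.1 hy with rfl | hy
    · exact hmono _ _ _ hm (min_le_right _ _) h2'
    · exact hmono _ _ _ hm (min_le_left _ _) (h2 y hy)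

lemma unif_indep (S S' : Multiset (K × K)) :
    ∃ δ > 0, δ ≤ 1 ∧ ∀ X ∈ S, ∀ Y ∈ S', wdg X Y ≠ 0 →
      ∀ Z : K × K, δ * ‖Z‖ ≤ max ‖wdg Z X‖ ‖wdg Z Y‖ := by
  obtain ⟨δ, h0, h1, h2⟩ := unif_pos (S.toFinset ×ˢ S'.toFinset)
    (fun p δ => wdg p.1 p.2 ≠ 0 → ∀ Z : K × K, δ * ‖Z‖ ≤ max ‖wdg Z p.1‖ ‖wdg Z p.2‖)
    (by
      intro p δ δ' h0 hle h hp Z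
      exact (mul_le_mul_of_nonneg_right hle (norm_nonneg _)).trans (h hp Z))
    (by
      rintro ⟨X, Y⟩ -
      by_cases hw : wdg X Y = 0
      · exact ⟨1, one_pos, fun h => absurd hw h⟩
      · have hw' : 0 < ‖wdg X Y‖ := norm_pos_iff.2 hw
        set B := max ‖X‖ ‖Y‖ + 1 with hB
        have hBp : 0 < B := by positivity
        refine ⟨‖wdg X Y‖ / B, by positivity, fun _ Z => ?_⟩
        rw [div_mul_eq_mul_div, div_le_iff₀ hBp]
        refine (wdg_indep Z X Y).trans (max_le ?_ ?_)
        · have : ‖Y‖ ≤ B := by rw [hB]; linarith [le_max_right ‖X‖ ‖Y‖]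
          exact mul_le_mul (le_max_left _ _) this (norm_nonneg _)
            (le_max_of_le_left (norm_nonneg _))
        · have : ‖X‖ ≤ B := by rw [hB]; linarith [le_max_left ‖X‖ ‖Y‖]
          exact mul_le_mul (le_max_right _ _) this (norm_nonneg _)
            (le_max_of_le_left (norm_nonneg _)))
  refine ⟨δ, h0, h1, fun X hX Y hY => ?_⟩
  exact h2 (X, Y) (by simp [hX, hY])

/-- Generic, nondegenerate sets. -/
structure GoodSet (T : Set (K × K)) : Prop where
  gen : ∀ S : Multiset (K × K), ∃ Z ∈ T, ∀ X ∈ S, ∀ Z' ∈ T, ‖wdg Z' X‖ ≤ ‖wdg Z X‖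
  nondeg : ∀ X : K × K, X ≠ 0 → ∃ Z ∈ T, wdg Z X ≠ 0

/-- The associated norm. -/
noncomputable def nu (T : Set (K × K)) (X : K × K) : ℝ := sSup ((fun Z => ‖wdg Z X‖) '' T)

lemma GoodSet.le_nu {T : Set (K × K)} (hT : GoodSet T) {Z : K × K} (hZ : Z ∈ T) (X : K × K) :
    ‖wdg Z X‖ ≤ nu T X := by
  obtain ⟨W, hW, h⟩ := hT.gen {X}
  refine le_csSup ⟨‖wdg W X‖, ?_⟩ ⟨Z, hZ, rfl⟩
  rintro _ ⟨V, hV, rfl⟩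
  exact h X (by simp) V hV

lemma GoodSet.exists_nu {T : Set (K × K)} (hT : GoodSet T) (S : Multiset (K × K)) :
    ∃ Z ∈ T, ∀ X ∈ S, ‖wdg Z X‖ = nu T X := by
  obtain ⟨Z, hZ, h⟩ := hT.gen S
  refine ⟨Z, hZ, fun X hX => le_antisymm (hT.le_nu hZ X) ?_⟩
  refine csSup_le ⟨_, Z, hZ, rfl⟩ ?_
  rintro _ ⟨V, hV, rfl⟩
  exact h X hX V hV

lemma GoodSet.nu_pos {T : Set (K × K)} (hT : GoodSet T) {X : K × K} (hX : X ≠ 0) :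
    0 < nu T X := by
  obtain ⟨Z, hZ, h⟩ := hT.nondeg X hX
  exact (norm_pos_iff.2 h).trans_le (hT.le_nu hZ X)

/-- The total size. -/
noncomputable def NN (T : Set (K × K)) : ℝ := max (nu T (0, 1)) (nu T (1, 0))

lemma wdg_e2 (Z : K × K) : wdg Z (0, 1) = Z.1 := by simp [wdg]
lemma wdg_e1 (Z : K × K) : wdg Z (1, 0) = - Z.2 := by simp [wdg]

lemma norm_eq_wdg (Z : K × K) : ‖Z‖ = max ‖wdg Z (0, 1)‖ ‖wdg Z (1, 0)‖ := by
  rw [wdg_e1, wdg_e2, norm_neg, Prod.norm_def]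

lemma GoodSet.le_NN {T : Set (K × K)} (hT : GoodSet T) {Z : K × K} (hZ : Z ∈ T) :
    ‖Z‖ ≤ NN T := by
  rw [norm_eq_wdg]
  exact max_le_max (hT.le_nu hZ _) (hT.le_nu hZ _)

lemma GoodSet.exists_NN {T : Set (K × K)} (hT : GoodSet T) : ∃ Z ∈ T, ‖Z‖ = NN T := by
  obtain ⟨Z, hZ, h⟩ := hT.exists_nu {(0, 1), (1, 0)}
  refine ⟨Z, hZ, ?_⟩
  rw [norm_eq_wdg, h _ (by simp), h _ (by simp), NN]

lemma GoodSet.NN_pos {T : Set (K × K)} (hT : GoodSet T) : 0 < NN T :=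
  (hT.nu_pos (X := (0, 1)) (by simp)).trans_le (le_max_left _ _)

lemma GoodSet.nu_le {T : Set (K × K)} (hT : GoodSet T) (X : K × K) :
    nu T X ≤ NN T * ‖X‖ := by
  obtain ⟨Z, hZ, h⟩ := hT.exists_nu {X}
  rw [← h X (by simp)]
  exact (norm_wdg_le Z X).trans (mul_le_mul_of_nonneg_right (hT.le_NN hZ) (norm_nonneg _))

lemma GoodSet.nu_ge {T : Set (K × K)} (hT : GoodSet T) : ∃ b > 0, ∀ X, b * ‖X‖ ≤ nu T X := by
  obtain ⟨Z1, hZ1, h1⟩ := hT.nondeg (0, 1) (by simp)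
  have hne : Z1 ≠ 0 := by rintro rfl; simp [wdg] at h1
  obtain ⟨Z2, hZ2, h2⟩ := hT.nondeg Z1 hne
  obtain ⟨δ, h0, -, hδ⟩ := unif_indep {Z2} {Z1}
  refine ⟨δ, h0, fun X => (hδ Z2 (by simp) Z1 (by simp) h2 X).trans (max_le ?_ ?_)⟩
  · rw [wdg_swap, norm_neg]; exact hT.le_nu hZ2 X
  · rw [wdg_swap, norm_neg]; exact hT.le_nu hZ1 X

lemma GoodSet.equiv {T T' : Set (K × K)} (hT : GoodSet T) (hT' : GoodSet T') :
    ∃ L : ℝ, 1 ≤ L ∧ (∀ X, nu T X ≤ L * nu T' X) ∧ ∀ X, nu T' X ≤ L * nu T X := by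
  obtain ⟨b, hb, h⟩ := hT.nu_ge
  obtain ⟨b', hb', h'⟩ := hT'.nu_ge
  have aux : ∀ {T T' : Set (K × K)} (hT : GoodSet T) (hT' : GoodSet T') (b : ℝ), 0 < b →
      (∀ X, b * ‖X‖ ≤ nu T' X) → ∀ L ≥ NN T / b, ∀ X, nu T X ≤ L * nu T' X := by
    intro T T' hT hT' b hb h L hL X
    have h1 := hT.nu_le X
    have h2 := h X
    have h3 : 0 ≤ nu T' X := (mul_nonneg hb.le (norm_nonneg _)).trans h2
    calc nu T X ≤ NN T * ‖X‖ := h1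
      _ = NN T / b * (b * ‖X‖) := by field_simp
      _ ≤ NN T / b * nu T' X := mul_le_mul_of_nonneg_left h2 (div_nonneg hT.NN_pos.le hb.le)
      _ ≤ L * nu T' X := mul_le_mul_of_nonneg_right hL h3
  refine ⟨max 1 (max (NN T / b') (NN T' / b)), le_max_left _ _, ?_, ?_⟩
  · exact aux hT hT' b' hb' h' _ ((le_max_left _ _).trans (le_max_right _ _))
  · exact aux hT' hT b hb h _ ((le_max_right _ _).trans (le_max_right _ _))

/-- An abstract homogeneous self-map of `K²` of degree `d`. -/
structure HomMap (F : K × K → K × K) (d : ℕ) (S1 : K × K → Multiset (K × K)) : Prop where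
  hd : 2 ≤ d
  nz : ∀ Z, Z ≠ 0 → F Z ≠ 0
  card : ∀ A, A ≠ 0 → (S1 A).card = d
  S1nz : ∀ A, A ≠ 0 → ∀ X ∈ S1 A, X ≠ 0
  fac : ∀ A, A ≠ 0 → ∀ Z, wdg (F Z) A = ((S1 A).map (wdg Z)).prod

/-- The iterated factorisation. -/
noncomputable def Sn (S1 : K × K → Multiset (K × K)) : ℕ → K × K → Multiset (K × K)
  | 0, A => {A}
  | n + 1, A => (Sn S1 n A).bind S1

lemma norm_multiset_prod (s : Multiset K) : ‖s.prod‖ = (s.map (‖·‖)).prod := by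
  simpa using (Multiset.prod_hom s (normHom : K →*₀ ℝ)).symm

namespace HomMap

variable {F : K × K → K × K} {d : ℕ} {S1 : K × K → Multiset (K × K)}

lemma iter_nz (h : HomMap F d S1) (n : ℕ) {Z : K × K} (hZ : Z ≠ 0) : F^[n] Z ≠ 0 := by
  induction n generalizing Z with
  | zero => simpa
  | succ n ih => rw [Function.iterate_succ_apply]; exact ih (h.nz _ hZ)

lemma Sn_nz (h : HomMap F d S1) (n : ℕ) {A : K × K} (hA : A ≠ 0) : ∀ X ∈ Sn S1 n A, X ≠ 0 := by
  induction n with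
  | zero => simpa [Sn]
  | succ n ih =>
    intro X hX
    simp only [Sn, Multiset.mem_bind] at hX
    obtain ⟨Y, hY, hX⟩ := hX
    exact h.S1nz Y (ih Y hY) X hX

lemma Sn_card (h : HomMap F d S1) (n : ℕ) {A : K × K} (hA : A ≠ 0) :
    (Sn S1 n A).card = d ^ n := by
  induction n with
  | zero => simp [Sn]
  | succ n ih =>
    simp only [Sn, Multiset.card_bind]
    rw [Multiset.map_congr rfl (g := fun _ => d)
      (fun X hX => by simpa using h.card X (h.Sn_nz n hA X hX))]
    simp [ih, pow_succ]

lemma Sn_fac (h : HomMap F d S1) (n : ℕ) {A : K × K} (hA : A ≠ 0) (Z : K × K) :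
    wdg (F^[n] Z) A = ((Sn S1 n A).map (wdg Z)).prod := by
  induction n generalizing Z with
  | zero => simp [Sn]
  | succ n ih =>
    rw [Function.iterate_succ_apply, ih]
    simp only [Sn, Multiset.map_bind, Multiset.prod_bind]
    congr 1
    exact Multiset.map_congr rfl (fun X hX => h.fac X (h.Sn_nz n hA X hX) Z)

lemma Sn_fac_norm (h : HomMap F d S1) (n : ℕ) {A : K × K} (hA : A ≠ 0) (Z : K × K) :
    ‖wdg (F^[n] Z) A‖ = ((Sn S1 n A).map (fun X => ‖wdg Z X‖)).prod := by
  rw [h.Sn_fac n hA, norm_multiset_prod, Multiset.map_map]; rfl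

lemma iter_good (h : HomMap F d S1) (n : ℕ) {T : Set (K × K)} (hT : GoodSet T) :
    GoodSet (F^[n] '' T) := by
  constructor
  · intro S
    obtain ⟨Z, hZ, hg⟩ := hT.gen ((S.filter (· ≠ 0)).bind (Sn S1 n))
    refine ⟨F^[n] Z, ⟨Z, hZ, rfl⟩, ?_⟩
    rintro X hX _ ⟨W, hW, rfl⟩
    by_cases hX0 : X = 0
    · simp [hX0, wdg]
    rw [h.Sn_fac_norm n hX0, h.Sn_fac_norm n hX0]
    refine Multiset.prod_map_le_prod_map₀ _ _ (fun _ _ => norm_nonneg _) ?_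
    intro Y hY
    refine hg Y ?_ W hW
    rw [Multiset.mem_bind]
    exact ⟨X, by simp [hX, hX0], hY⟩
  · intro X hX
    obtain ⟨Z, hZ, hg⟩ := hT.exists_nu (Sn S1 n X)
    refine ⟨F^[n] Z, ⟨Z, hZ, rfl⟩, ?_⟩
    rw [h.Sn_fac n hX]
    refine Multiset.prod_ne_zero ?_
    rw [Multiset.mem_map]
    rintro ⟨Y, hY, h0⟩
    have h1 := hg Y hY
    rw [h0, norm_zero] at h1
    exact (hT.nu_pos (h.Sn_nz n hX Y hY)).ne h1

lemma nu_iter (h : HomMap F d S1) (n : ℕ) {T : Set (K × K)} (hT : GoodSet T)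
    {A : K × K} (hA : A ≠ 0) :
    nu (F^[n] '' T) A = ((Sn S1 n A).map (nu T)).prod := by
  have hT' := h.iter_good n hT
  apply le_antisymm
  · obtain ⟨_, ⟨Z, hZ, rfl⟩, hg⟩ := hT'.exists_nu {A}
    rw [← hg A (by simp), h.Sn_fac_norm n hA]
    exact Multiset.prod_map_le_prod_map₀ _ _ (fun _ _ => norm_nonneg _)
      (fun Y _ => hT.le_nu hZ Y)
  · obtain ⟨Z, hZ, hg⟩ := hT.exists_nu (Sn S1 n A)
    rw [← Multiset.map_congr rfl hg, ← h.Sn_fac_norm n hA]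
    exact hT'.le_nu ⟨Z, hZ, rfl⟩ A

lemma growth_one (h : HomMap F d S1) : ∃ C : ℝ, 1 ≤ C ∧ ∀ Z, ‖F Z‖ ≤ C * ‖Z‖ ^ d ∧
    ‖Z‖ ^ d ≤ C * ‖F Z‖ := by
  have e1 : ((1, 0) : K × K) ≠ 0 := by simp
  have e2 : ((0, 1) : K × K) ≠ 0 := by simp
  have facn : ∀ A, A ≠ 0 → ∀ Z, ‖wdg (F Z) A‖ = ((S1 A).map (fun X => ‖wdg Z X‖)).prod := by
    intro A hA Z
    rw [h.fac A hA, norm_multiset_prod, Multiset.map_map]; rfl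
  have up : ∀ A, A ≠ 0 → ∃ C : ℝ, ∀ Z, ‖wdg (F Z) A‖ ≤ C * ‖Z‖ ^ d := by
    intro A hA
    refine ⟨((S1 A).map (fun X => ‖X‖)).prod, fun Z => ?_⟩
    rw [facn A hA]
    refine (Multiset.prod_map_le_prod_map₀ _ (fun X => ‖X‖ * ‖Z‖) (fun _ _ => norm_nonneg _)
      (fun X _ => by rw [mul_comm]; exact norm_wdg_le Z X)).trans ?_
    rw [Multiset.prod_map_mul]
    simp [h.card A hA]
  obtain ⟨C1, hC1⟩ := up _ e1
  obtain ⟨C2, hC2⟩ := up _ e2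
  obtain ⟨δ, h0, h1, hδ⟩ := unif_indep (S1 (1, 0)) (S1 (0, 1))
  have hw : ∀ X ∈ S1 (1, 0), ∀ Y ∈ S1 (0, 1), wdg X Y ≠ 0 := by
    intro X hX Y hY hXY
    have hX0 := h.S1nz _ e1 X hX
    have a1 : wdg (F X) (1, 0) = 0 := by
      rw [h.fac _ e1]
      exact Multiset.prod_eq_zero (Multiset.mem_map.2 ⟨X, hX, wdg_self X⟩)
    have a2 : wdg (F X) (0, 1) = 0 := by
      rw [h.fac _ e2]
      exact Multiset.prod_eq_zero (Multiset.mem_map.2 ⟨Y, hY, hXY⟩)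
    refine h.nz X hX0 ?_
    rw [wdg_e1, neg_eq_zero] at a1
    rw [wdg_e2] at a2
    exact Prod.ext a2 a1
  have low : ∀ A, A ≠ 0 → ∀ Z, (∀ X ∈ S1 A, δ * ‖Z‖ ≤ ‖wdg Z X‖) →
      (δ * ‖Z‖) ^ d ≤ ‖wdg (F Z) A‖ := by
    intro A hA Z hZ
    rw [facn A hA]
    have := Multiset.prod_map_le_prod_map₀ (s := S1 A) (fun _ => δ * ‖Z‖) (fun X => ‖wdg Z X‖)
      (fun _ _ => by positivity) hZ
    simpa [h.card A hA] using this
  have hlow : ∀ Z, (δ * ‖Z‖) ^ d ≤ ‖F Z‖ := by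
    intro Z
    rw [norm_eq_wdg (F Z)]
    by_cases hc : ∀ X ∈ S1 (1, 0), δ * ‖Z‖ ≤ ‖wdg Z X‖
    · exact (low _ e1 Z hc).trans (le_max_right _ _)
    · push Not at hc
      obtain ⟨X, hX, hlt⟩ := hc
      refine (low _ e2 Z fun Y hY => ?_).trans (le_max_left _ _)
      rcases le_max_iff.1 (hδ X hX Y hY (hw X hX Y hY) Z) with h | h
      · linarith
      · exact h
  refine ⟨max 1 (max (max C1 C2) ((δ⁻¹) ^ d)), le_max_left _ _, fun Z => ⟨?_, ?_⟩⟩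
  · rw [norm_eq_wdg (F Z)]
    have hz : 0 ≤ ‖Z‖ ^ d := by positivity
    refine max_le ((hC2 Z).trans (mul_le_mul_of_nonneg_right ?_ hz))
      ((hC1 Z).trans (mul_le_mul_of_nonneg_right ?_ hz))
    · simp
    · simp
  · have := hlow Z
    rw [mul_pow] at this
    calc ‖Z‖ ^ d = (δ⁻¹) ^ d * (δ ^ d * ‖Z‖ ^ d) := by
          rw [← mul_assoc, ← mul_pow, inv_mul_cancel₀ h0.ne']; simp
      _ ≤ (δ⁻¹) ^ d * ‖F Z‖ := mul_le_mul_of_nonneg_left this (by positivity)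
      _ ≤ _ := mul_le_mul_of_nonneg_right (by simp) (norm_nonneg _)

lemma growth (h : HomMap F d S1) (k : ℕ) : ∃ C : ℝ, 1 ≤ C ∧ ∀ Z,
    ‖F^[k] Z‖ ≤ C * ‖Z‖ ^ (d ^ k) ∧ ‖Z‖ ^ (d ^ k) ≤ C * ‖F^[k] Z‖ := by
  induction k with
  | zero => exact ⟨1, le_rfl, by simp⟩
  | succ k ih =>
    obtain ⟨C, hC, hZ⟩ := ih
    obtain ⟨D, hD, hW⟩ := h.growth_one
    refine ⟨D * C ^ d, one_le_mul_of_one_le_of_one_le hD (one_le_pow₀ hC), fun Z => ?_⟩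
    rw [Function.iterate_succ_apply', pow_succ, pow_mul]
    constructor
    · calc _ ≤ D * ‖F^[k] Z‖ ^ d := (hW _).1
        _ ≤ D * (C * ‖Z‖ ^ (d ^ k)) ^ d := by gcongr; exact (hZ Z).1
        _ = _ := by ring
    · calc _ ≤ (C * ‖F^[k] Z‖) ^ d := by gcongr; exact (hZ Z).2
        _ = C ^ d * ‖F^[k] Z‖ ^ d := by ring
        _ ≤ C ^ d * (D * ‖F (F^[k] Z)‖) := by gcongr; exact (hW _).2
        _ = _ := by ring

lemma NN_growth (h : HomMap F d S1) (k : ℕ) : ∃ C : ℝ, 1 ≤ C ∧ ∀ T, GoodSet T →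
    NN (F^[k] '' T) ≤ C * NN T ^ (d ^ k) ∧ NN T ^ (d ^ k) ≤ C * NN (F^[k] '' T) := by
  obtain ⟨C, hC, hZ⟩ := h.growth k
  refine ⟨C, hC, fun T hT => ⟨?_, ?_⟩⟩
  · obtain ⟨_, ⟨W, hW, rfl⟩, he⟩ := (h.iter_good k hT).exists_NN
    rw [← he]
    refine (hZ W).1.trans ?_
    gcongr
    exact hT.le_NN hW
  · obtain ⟨W, hW, he⟩ := hT.exists_NN
    rw [← he]
    refine (hZ W).2.trans ?_
    gcongr
    exact (h.iter_good k hT).le_NN ⟨W, hW, rfl⟩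

end HomMap

/-- generalised chordal distance to `A`. -/
noncomputable def RR (T : Set (K × K)) (A : K × K) : ℝ := nu T A / NN T

lemma GoodSet.RR_pos {T : Set (K × K)} (hT : GoodSet T) {A : K × K} (hA : A ≠ 0) : 0 < RR T A :=
  div_pos (hT.nu_pos hA) hT.NN_pos

namespace HomMap

variable {F : K × K → K × K} {d : ℕ} {S1 : K × K → Multiset (K × K)}

/-- The key `k`-step comparison. -/
lemma kstep (h : HomMap F d S1) (k M : ℕ) {A : K × K} (hA : A ≠ 0)
    (hM : ∀ y, y ≠ 0 → (Sn S1 k A).countP (fun X => wdg X y = 0) ≤ M) :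
    ∃ C : ℝ, 0 < C ∧ ∀ U U' : Set (K × K), GoodSet U → GoodSet U' → ∀ Λ : ℝ, 1 ≤ Λ →
      (∀ X, nu U X ≤ Λ * nu U' X) → (∀ X, nu U' X ≤ Λ * nu U X) →
      RR (F^[k] '' U') A ≤ C * Λ ^ (2 * M) * RR (F^[k] '' U) A := by
  obtain ⟨C, hC, hN⟩ := h.NN_growth k
  obtain ⟨δ, h0, h1, hδ⟩ := unif_indep (Sn S1 k A) (Sn S1 k A)
  obtain ⟨B, hB1, hB⟩ : ∃ B : ℝ, 1 ≤ B ∧ ∀ X ∈ Sn S1 k A, ‖X‖ ≤ B := by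
    obtain ⟨b, hb0, hb1, hb⟩ := unif_pos (Sn S1 k A).toFinset (fun X b => ‖X‖ ≤ b⁻¹)
      (fun X δ δ' h0 hle hX => hX.trans (by gcongr))
      (fun X _ => ⟨(‖X‖ + 1)⁻¹, by positivity, by simp⟩)
    exact ⟨b⁻¹, (one_le_inv₀ hb0).2 hb1, fun X hX => hb X (by simpa using hX)⟩
  have hSn0 := h.Sn_nz k hA
  have hcard := h.Sn_card k hA
  set S := Sn S1 k A with hS
  have hBδ : 1 ≤ B / δ := by rw [le_div_iff₀ h0]; linarith
  refine ⟨C * C * (B / δ) ^ (d ^ k), by positivity, ?_⟩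
  intro U U' hU hU' Λ hΛ hUU' hU'U
  have hNU := hU.NN_pos
  have hNU' := hU'.NN_pos
  have hFU := (h.iter_good k hU).NN_pos
  have hFU' := (h.iter_good k hU').NN_pos
  have hNle : NN U ≤ Λ * NN U' := by
    rw [NN, NN, mul_max_of_nonneg _ _ (by linarith)]
    exact max_le_max (hUU' _) (hUU' _)
  -- the two products
  have key : (S.map (fun X => nu U' X / NN U')).prod ≤
      (B / δ) ^ (d ^ k) * Λ ^ (2 * M) * (S.map (fun X => nu U X / NN U)).prod := by
    have hcmp : ∃ p : K × K → Prop, S.countP p ≤ M ∧ ∀ X ∈ S, nu U' X / NN U' ≤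
        (if p X then Λ ^ 2 else 1) * (B / δ) * (nu U X / NN U) := by
      have hbig : ∀ X ∈ S, δ ≤ nu U X / NN U →
          nu U' X / NN U' ≤ (B / δ) * (nu U X / NN U) := by
        intro X hX hl
        have a1 : nu U' X / NN U' ≤ B := by
          rw [div_le_iff₀ hNU', mul_comm]
          exact (hU'.nu_le X).trans (mul_le_mul_of_nonneg_left (hB X hX) hNU'.le)
        calc _ ≤ B := a1
          _ = B / δ * δ := by field_simp
          _ ≤ _ := by gcongr
      by_cases hc : ∀ X ∈ S, δ ≤ nu U X / NN U
      · exact ⟨fun X => X = (0 : K × K), le_of_eq_of_le ((@Multiset.countP_eq_zero _ _ (fun _ => Classical.propDecidable _) S).2 (fun X hX h => hSn0 X hX h)) (Nat.zero_le _), fun X hX => by rw [if_neg (hSn0 X hX), one_mul]; exact hbig X hX (hc X hX)⟩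
      · push Not at hc
        obtain ⟨X0, hX0, hlt⟩ := hc
        refine ⟨fun X => wdg X X0 = 0, hM X0 (hSn0 X0 hX0), fun X hX => ?_⟩
        by_cases hp : wdg X X0 = 0
        · simp only [hp, if_true]
          have a1 : nu U' X / NN U' ≤ Λ ^ 2 * (nu U X / NN U) := by
            rw [div_le_iff₀ hNU']
            have := hU.nu_pos (hSn0 X hX)
            calc nu U' X ≤ Λ * nu U X := hU'U X
              _ = Λ * (nu U X / NN U) * NN U := by field_simp
              _ ≤ Λ * (nu U X / NN U) * (Λ * NN U') := by gcongr
              _ = _ := by ring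
          have := hU.nu_pos (hSn0 X hX)
          calc _ ≤ Λ ^ 2 * 1 * (nu U X / NN U) := by simpa using a1
            _ ≤ _ := by gcongr
        · simp only [hp, if_false, one_mul]
          refine hbig X hX ?_
          rw [le_div_iff₀ hNU]
          obtain ⟨Z, hZ, he⟩ := hU.exists_NN
          rw [← he]
          have hlt' : nu U X0 < δ * ‖Z‖ := by
            rw [div_lt_iff₀ hNU] at hlt; rwa [he]
          rcases le_max_iff.1 (hδ X hX X0 hX0 hp Z) with h | h
          · exact h.trans (hU.le_nu hZ X)
          · have := hU.le_nu hZ X0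
            linarith
    obtain ⟨p, hp, hX⟩ := hcmp
    refine (Multiset.prod_map_le_prod_map₀ _ _ (fun X hX => ?_) hX).trans ?_
    · exact div_nonneg (hU'.nu_pos (hSn0 X hX)).le hNU'.le
    rw [Multiset.prod_map_mul, Multiset.prod_map_mul]
    have hnn : 0 ≤ (S.map (fun X => nu U X / NN U)).prod := by
      refine Multiset.prod_nonneg ?_
      intro x hx
      obtain ⟨X, hX, rfl⟩ := Multiset.mem_map.1 hx
      exact div_nonneg (hU.nu_pos (hSn0 X hX)).le hNU.le
    refine mul_le_mul_of_nonneg_right ?_ hnn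
    rw [mul_comm]
    have e1 : (S.map (fun _ => B / δ)).prod = (B / δ) ^ (d ^ k) := by
      simp [hcard]
    have e2 : ∀ S : Multiset (K × K), (S.map (fun X => if p X then Λ ^ 2 else 1)).prod
        = (Λ ^ 2) ^ (S.countP p) := by
      intro S
      induction S using Multiset.induction_on with
      | empty => simp
      | cons X S ih =>
        rw [Multiset.map_cons, Multiset.prod_cons, ih, Multiset.countP_cons]
        split_ifs <;> simp [pow_succ, mul_comm]
    rw [e1, e2, ← pow_mul]
    gcongr
  have hprod : ∀ V, GoodSet V → (S.map (fun X => nu V X / NN V)).prod =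
      nu (F^[k] '' V) A / NN V ^ (d ^ k) := by
    intro V hV
    rw [h.nu_iter k hV hA, Multiset.prod_map_div]
    rw [Multiset.map_const', Multiset.prod_replicate, hcard]
  rw [hprod U hU, hprod U' hU'] at key
  have hA1 := (h.iter_good k hU).nu_pos hA
  have hA2 := (h.iter_good k hU').nu_pos hA
  have b1 : RR (F^[k] '' U') A ≤ C * (nu (F^[k] '' U') A / NN U' ^ (d ^ k)) := by
    rw [RR, div_le_iff₀ hFU']
    calc nu (F^[k] '' U') A
        = nu (F^[k] '' U') A / NN U' ^ (d ^ k) * NN U' ^ (d ^ k) := by field_simp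
      _ ≤ nu (F^[k] '' U') A / NN U' ^ (d ^ k) * (C * NN (F^[k] '' U')) := by
          gcongr; exact (hN U' hU').2
      _ = _ := by ring
  have b2 : nu (F^[k] '' U) A / NN U ^ (d ^ k) ≤ C * RR (F^[k] '' U) A := by
    rw [RR, div_le_iff₀ (by positivity)]
    calc nu (F^[k] '' U) A
        = nu (F^[k] '' U) A / NN (F^[k] '' U) * NN (F^[k] '' U) := by field_simp
      _ ≤ nu (F^[k] '' U) A / NN (F^[k] '' U) * (C * NN U ^ (d ^ k)) := by
          gcongr; exact (hN U hU).1
      _ = _ := by ring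
  calc _ ≤ C * (nu (F^[k] '' U') A / NN U' ^ (d ^ k)) := b1
    _ ≤ C * ((B / δ) ^ (d ^ k) * Λ ^ (2 * M) * (nu (F^[k] '' U) A / NN U ^ (d ^ k))) := by
        gcongr
    _ ≤ C * ((B / δ) ^ (d ^ k) * Λ ^ (2 * M) * (C * RR (F^[k] '' U) A)) := by gcongr
    _ = _ := by ring

lemma iter_equiv (h : HomMap F d S1) (m : ℕ) {T T' : Set (K × K)} (hT : GoodSet T)
    (hT' : GoodSet T') {L : ℝ} (hL : 1 ≤ L) (hle : ∀ X, nu T X ≤ L * nu T' X) (X : K × K) :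
    nu (F^[m] '' T) X ≤ L ^ (d ^ m) * nu (F^[m] '' T') X := by
  by_cases hX : X = 0
  · have : ∀ V, GoodSet V → nu V X = 0 := by
      intro V hV
      obtain ⟨Z, hZ, he⟩ := hV.exists_nu {X}
      rw [← he X (by simp), hX]
      simp [wdg]
    rw [this _ (h.iter_good m hT), this _ (h.iter_good m hT')]; simp
  rw [h.nu_iter m hT hX, h.nu_iter m hT' hX]
  refine (Multiset.prod_map_le_prod_map₀ _ _
    (fun Y hY => (hT.nu_pos (h.Sn_nz m hX Y hY)).le) (fun Y _ => hle Y)).trans ?_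
  rw [Multiset.prod_map_mul]
  simp [h.Sn_card m hX]

/-- Main abstract estimate. -/
lemma main_abstract (h : HomMap F d S1) {A : K × K} (hA : A ≠ 0)
    (hcount : ∀ c : ℝ, 0 < c → ∃ k : ℕ, ∃ M : ℕ, (M : ℝ) ≤ c * (d : ℝ) ^ k ∧
      ∀ y, y ≠ 0 → (Sn S1 k A).countP (fun X => wdg X y = 0) ≤ M)
    {T : Set (K × K)} (hT : GoodSet T) (ε : ℝ) (hε : 0 < ε) :
    ∀ᶠ n : ℕ in atTop, Real.exp (-ε * (d : ℝ) ^ n) ≤ RR (F^[n] '' T) A := by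
  have hd2 : (2 : ℝ) ≤ d := by exact_mod_cast h.hd
  have hT' : GoodSet (F '' T) := h.iter_good 1 hT
  obtain ⟨L, hL, hl1, hl2⟩ := hT.equiv hT'
  have hlogL : 0 ≤ Real.log L := Real.log_nonneg hL
  set c : ℝ := ε / (4 * (Real.log L + 1)) with hc
  have hcpos : 0 < c := by positivity
  have hcL : 2 * c * Real.log L ≤ ε / 2 := by
    rw [hc]
    have : ε / (4 * (Real.log L + 1)) * (Real.log L + 1) = ε / 4 := by field_simp
    nlinarith
  obtain ⟨k, M, hM, hcnt⟩ := hcount c hcpos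
  obtain ⟨C, hC, hstep⟩ := h.kstep k M hA hcnt
  -- logarithmic recursion
  set x : ℕ → ℝ := fun n => - Real.log (RR (F^[n] '' T) A) with hx
  have hrec : ∀ m, x (m + k + 1) ≤ x (m + k) + (|Real.log C| + ε / 2 * (d : ℝ) ^ (m + k)) := by
    intro m
    have hs := hstep (F^[m] '' (F '' T)) (F^[m] '' T) (h.iter_good m hT') (h.iter_good m hT)
      (L ^ (d ^ m)) (one_le_pow₀ hL) (h.iter_equiv m hT' hT hL hl2) (h.iter_equiv m hT hT' hL hl1)
    have e1 : F^[k] '' (F^[m] '' T) = F^[m + k] '' T := by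
      rw [← Set.image_comp, ← Function.iterate_add, add_comm]
    have e2 : F^[k] '' (F^[m] '' (F '' T)) = F^[m + k + 1] '' T := by
      rw [← Set.image_comp, ← Function.iterate_add, ← Set.image_comp, add_comm k m,
        Function.iterate_succ]
    rw [e1, e2] at hs
    have p1 := (h.iter_good (m + k) hT).RR_pos hA
    have p2 := (h.iter_good (m + k + 1) hT).RR_pos hA
    have hLp : 0 < L := by linarith
    have hlog := Real.log_le_log p1 hs
    rw [Real.log_mul (by positivity) p2.ne', Real.log_mul hC.ne' (by positivity), Real.log_pow,
      Real.log_pow] at hlog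
    push_cast at hlog
    have hMb : 2 * (M : ℝ) * ((d : ℝ) ^ m * Real.log L) ≤ ε / 2 * (d : ℝ) ^ (m + k) := by
      have q : (0 : ℝ) ≤ (d : ℝ) ^ m * Real.log L := by positivity
      calc 2 * (M : ℝ) * ((d : ℝ) ^ m * Real.log L)
          ≤ 2 * (c * (d : ℝ) ^ k) * ((d : ℝ) ^ m * Real.log L) := by gcongr
        _ = (2 * c * Real.log L) * (d : ℝ) ^ (m + k) := by rw [pow_add]; ring
        _ ≤ _ := by gcongr
    have := le_abs_self (Real.log C)
    simp only [hx]
    linarith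
  have hsum : ∀ m, x (m + k) ≤ x k + m * |Real.log C| + ε / 2 * (d : ℝ) ^ (m + k) := by
    intro m
    induction m with
    | zero => simp; positivity
    | succ m ih =>
      have := hrec m
      have e : (m + 1 + k) = m + k + 1 := by ring
      rw [e]
      push_cast
      have hp : (0 : ℝ) ≤ ε / 2 * (d : ℝ) ^ (m + k) := by positivity
      rw [pow_succ]
      nlinarith
  -- conclude
  have hlim : Tendsto (fun n : ℕ => (|x k| + n * |Real.log C|) / (d : ℝ) ^ n) atTop (𝓝 0) := by
    have t1 : Tendsto (fun n : ℕ => |x k| * ((d : ℝ)⁻¹) ^ n) atTop (𝓝 (|x k| * 0)) :=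
      (tendsto_pow_atTop_nhds_zero_of_lt_one (by positivity)
        (inv_lt_one_of_one_lt₀ (by linarith))).const_mul _
    have t2 := (tendsto_self_mul_const_pow_of_lt_one (r := (d : ℝ)⁻¹) (by positivity)
        (inv_lt_one_of_one_lt₀ (by linarith))).const_mul |Real.log C|
    have := t1.add t2
    simp only [mul_zero, add_zero] at this
    refine this.congr fun n => ?_
    rw [inv_pow]; field_simp
  filter_upwards [hlim.eventually_lt_const (half_pos hε), eventually_ge_atTop k] with n hn hnk
  obtain ⟨m, rfl⟩ := Nat.exists_eq_add_of_le' hnk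
  have hdp : (0 : ℝ) < (d : ℝ) ^ (m + k) := by positivity
  rw [div_lt_iff₀ hdp] at hn
  have h3 := hsum m
  have h4 := le_abs_self (x k)
  have h5 : (m : ℝ) * |Real.log C| ≤ ((m + k : ℕ) : ℝ) * |Real.log C| := by
    gcongr; simp
  have h6 : x (m + k) ≤ ε * (d : ℝ) ^ (m + k) := by linarith
  rw [← Real.le_log_iff_exp_le ((h.iter_good (m + k) hT).RR_pos hA)]
  simp only [hx] at h6
  linarith

end HomMap

end Abstract

section Counting

variable {K}
set_option linter.unusedSectionVars false

/-- Projection to `P^1`. -/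
noncomputable def toP (Z : K × K) : OnePoint K :=
  if Z.2 = 0 then OnePoint.infty else ((Z.1 / Z.2 : K) : OnePoint K)

lemma toP_eq_iff {Z X : K × K} (hZ : Z ≠ 0) (hX : X ≠ 0) : toP Z = toP X ↔ wdg Z X = 0 := by
  obtain ⟨z0, z1⟩ := Z
  obtain ⟨x0, x1⟩ := X
  unfold toP wdg
  by_cases h1 : z1 = 0 <;> by_cases h2 : x1 = 0
  · simp [h1, h2]
  · have : z0 ≠ 0 := by rintro rfl; simp [h1] at hZ
    simp [h1, h2, this]
  · have : x0 ≠ 0 := by rintro rfl; simp [h2] at hX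
    simp [h1, h2, this]
  · simp only [h1, h2, if_false, OnePoint.coe_eq_coe]
    rw [div_eq_div_iff h1 h2, sub_eq_zero, mul_comm x0 z1]

lemma homCoord_infty : homCoord K OnePoint.infty = (1, 0) := rfl

lemma homCoord_coe (a : K) : homCoord K (a : OnePoint K) = (a, 1) := rfl

lemma homCoord_ne (x : OnePoint K) : homCoord K x ≠ 0 := by
  induction x using OnePoint.rec with
  | infty => simp [homCoord_infty]
  | coe a => simp [homCoord_coe]

lemma toP_hom (x : OnePoint K) : toP (homCoord K x) = x := by
  induction x using OnePoint.rec with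
  | infty => simp [homCoord_infty, toP]
  | coe a => simp [homCoord_coe, toP]

/-- totally ramified points (set-theoretically). -/
def TRset {α : Type*} (g : α → α) : Set α := {q | ∀ z, g z = g q → z = q}

lemma finite_back {α : Type*} (g : α → α) {b : α} {p : ℕ} (hp : 0 < p) (hb : g^[p] b = b)
    (hTR : ∀ l < p, g^[l] b ∈ TRset g) (j : ℕ) :
    Set.Finite {z : α | ∃ n : ℕ, g^[n] z = g^[j] b} := by
  have hmod : ∀ l, g^[l] b = g^[l % p] b := by
    intro l
    exact (Function.IsPeriodicPt.iterate_mod_apply (f := g) (x := b) (n := p) hb l).symm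
  have hO : ∀ n l z, g^[n] z = g^[l] b → ∃ i, z = g^[i] b := by
    intro n
    induction n with
    | zero => intro l z h; exact ⟨l, h⟩
    | succ n ih =>
      intro l z h
      rw [Function.iterate_succ_apply] at h
      obtain ⟨i, hi⟩ := ih l _ h
      have h1 : g^[i] b = g (g^[i + p - 1] b) := by
        rw [← Function.iterate_succ_apply' g, Nat.succ_eq_add_one,
          show i + p - 1 + 1 = i + p by omega, Function.iterate_add_apply, hb]
      rw [h1] at hi
      refine ⟨i + p - 1, ?_⟩
      have hm : g^[i + p - 1] b ∈ TRset g := by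
        rw [hmod]; exact hTR _ (Nat.mod_lt _ hp)
      exact hm z hi
  refine ((Finset.range p).image (fun l => g^[l] b)).finite_toSet.subset ?_
  rintro z ⟨n, hn⟩
  obtain ⟨i, hi⟩ := hO n j z hn
  rw [hmod] at hi
  simp only [Finset.coe_image, Finset.coe_range, Set.mem_image, Set.mem_Iio]
  exact ⟨i % p, Nat.mod_lt _ hp, hi.symm⟩

lemma not_all_TR {α : Type*} (g : α → α) (hfin : (TRset g).Finite) {a q : α} {k : ℕ}
    (hk : (TRset g).ncard + 1 ≤ k) (hq : g^[k] q = a)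
    (ha : ¬ Set.Finite {z : α | ∃ n : ℕ, g^[n] z = a}) :
    ∃ i < (TRset g).ncard + 1, g^[i] q ∉ TRset g := by
  by_contra hc
  push Not at hc
  set L := (TRset g).ncard with hL
  have hnot : ¬ Set.InjOn (fun i => g^[i] q) (Finset.range (L + 1) : Set ℕ) := by
    intro hinj
    have h1 := Finset.card_image_of_injOn hinj
    have h2 : ((Finset.range (L + 1)).image (fun i => g^[i] q)).card ≤ hfin.toFinset.card := by
      apply Finset.card_le_card
      intro x hx
      simp only [Finset.mem_image, Finset.mem_range] at hx
      obtain ⟨i, hi, rfl⟩ := hx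
      simpa using hc i hi
    rw [← Set.ncard_eq_toFinset_card _ hfin] at h2
    simp at h1
    omega
  rw [Set.InjOn] at hnot
  push Not at hnot
  obtain ⟨i, hi, j, hj, he, hne⟩ := hnot
  simp only [Finset.coe_range, Set.mem_Iio] at hi hj
  have main : ∀ i j, i < j → j < L + 1 → g^[i] q = g^[j] q → False := by
    intro i j hij hj he
    apply ha
    have hb : g^[j - i] (g^[i] q) = g^[i] q := by
      rw [← Function.iterate_add_apply, Nat.sub_add_cancel hij.le, he]
    have := finite_back g (b := g^[i] q) (p := j - i) (by omega) hb
      (fun l hl => by rw [← Function.iterate_add_apply]; exact hc _ (by omega)) (k - i)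
    rwa [← Function.iterate_add_apply, Nat.sub_add_cancel (by omega), hq] at this
  rcases lt_or_gt_of_ne hne with h | h
  · exact main i j h hj he
  · exact main j i h hi he.symm

namespace HomMap

variable {F : K × K → K × K} {d : ℕ} {S1 : K × K → Multiset (K × K)}

/-- count of factors proportional to `y` -/
noncomputable def cnt (S1 : K × K → Multiset (K × K)) (A : K × K) (k : ℕ) (y : K × K) : ℕ :=
  (Sn S1 k A).countP (fun X => wdg X y = 0)

/-- local degree bound -/
noncomputable def ee (g : OnePoint K → OnePoint K) (d : ℕ) (q : OnePoint K) : ℕ :=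
  if q ∈ TRset g then d else d - 1

lemma cnt_succ (h : HomMap F d S1) {g : OnePoint K → OnePoint K}
    (hg : ∀ Z, Z ≠ 0 → toP (F Z) = g (toP Z)) {A : K × K} (hA : A ≠ 0) (k : ℕ) {y : K × K}
    (hy : y ≠ 0) : cnt S1 A (k + 1) y ≤ cnt S1 A k (F y) * ee g d (toP y) := by
  have one : ∀ X, X ≠ 0 → (S1 X).countP (fun Y => wdg Y y = 0) ≤
      if wdg X (F y) = 0 then ee g d (toP y) else 0 := by
    intro X hX
    split_ifs with hw
    · unfold ee
      split_ifs with hT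
      · rw [← h.card X hX]; exact Multiset.countP_le_card _ _
      · have hex : ∃ Y ∈ S1 X, ¬ wdg Y y = 0 := by
          simp only [TRset, Set.mem_setOf_eq, not_forall] at hT
          obtain ⟨z, hz, hne⟩ := hT
          have hz0 := homCoord_ne z
          have e1 : toP (F (homCoord K z)) = toP (F y) := by
            rw [hg _ hz0, hg _ hy, toP_hom, hz]
          rw [toP_eq_iff (h.nz _ hz0) (h.nz _ hy)] at e1
          have e2 := wdg_trans (h.nz _ hy) e1 (wdg_comm_zero hw)
          rw [h.fac X hX, Multiset.prod_eq_zero_iff, Multiset.mem_map] at e2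
          obtain ⟨Y, hY, hzY⟩ := e2
          refine ⟨Y, hY, fun hYy => hne ?_⟩
          have := wdg_trans (h.S1nz X hX Y hY) hzY hYy
          rw [← toP_eq_iff hz0 hy, toP_hom] at this
          exact this
        have hlt : (S1 X).countP (fun Y => wdg Y y = 0) < (S1 X).card := by
          refine lt_of_le_of_ne (Multiset.countP_le_card _ _) fun he => ?_
          rw [Multiset.countP_eq_card] at he
          obtain ⟨Y, hY, hn⟩ := hex
          exact hn (he Y hY)
        rw [h.card X hX] at hlt
        omega
    · rw [Nat.le_zero, Multiset.countP_eq_zero]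
      intro Y hY hYy
      apply hw
      apply wdg_comm_zero
      rw [h.fac X hX]
      exact Multiset.prod_eq_zero (Multiset.mem_map.2 ⟨Y, hY, wdg_comm_zero hYy⟩)
  have hnz := h.Sn_nz k hA
  unfold cnt
  rw [Sn]
  generalize Sn S1 k A = S at hnz
  induction S using Multiset.induction_on with
  | empty => simp
  | cons X S ih =>
    rw [Multiset.cons_bind, Multiset.countP_add, Multiset.countP_cons, add_mul]
    have h1 := ih (fun Y hY => hnz Y (Multiset.mem_cons_of_mem hY))
    have h2 := one X (hnz X (Multiset.mem_cons_self _ _))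
    split_ifs at h2 ⊢ <;> simp <;> omega

lemma cnt_add (h : HomMap F d S1) {g : OnePoint K → OnePoint K}
    (hg : ∀ Z, Z ≠ 0 → toP (F Z) = g (toP Z)) {A : K × K} (hA : A ≠ 0) (k l : ℕ) {y : K × K}
    (hy : y ≠ 0) : cnt S1 A (k + l) y ≤
      cnt S1 A k (F^[l] y) * ∏ i ∈ Finset.range l, ee g d (g^[i] (toP y)) := by
  induction l generalizing y with
  | zero => simp
  | succ l ih =>
    refine (h.cnt_succ hg hA (k + l) hy).trans ?_
    refine (Nat.mul_le_mul_right _ (ih (h.nz y hy))).trans ?_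
    rw [Finset.prod_range_succ', hg y hy, Function.iterate_succ_apply, mul_assoc]
    simp only [Function.iterate_succ_apply, Function.iterate_zero, id]
    exact le_rfl

lemma toP_iter (h : HomMap F d S1) {g : OnePoint K → OnePoint K}
    (hg : ∀ Z, Z ≠ 0 → toP (F Z) = g (toP Z)) (n : ℕ) {Z : K × K} (hZ : Z ≠ 0) :
    toP (F^[n] Z) = g^[n] (toP Z) := by
  induction n generalizing Z with
  | zero => simp
  | succ n ih => rw [Function.iterate_succ_apply, Function.iterate_succ_apply, ih (h.nz Z hZ), hg Z hZ]

lemma cnt_block (h : HomMap F d S1) {g : OnePoint K → OnePoint K}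
    (hg : ∀ Z, Z ≠ 0 → toP (F Z) = g (toP Z)) {A : K × K} (hA : A ≠ 0)
    (hfin : (TRset g).Finite)
    (ha : ¬ Set.Finite {z : OnePoint K | ∃ n : ℕ, g^[n] z = toP A}) (j : ℕ) {y : K × K}
    (hy : y ≠ 0) : cnt S1 A (((TRset g).ncard + 1) * j) y ≤
      (d ^ (TRset g).ncard * (d - 1)) ^ j := by
  induction j generalizing y with
  | zero =>
    simp only [mul_zero, pow_zero, cnt, Sn]
    exact (Multiset.countP_le_card _ _).trans (by simp)
  | succ j ih =>
    by_cases h0 : cnt S1 A (((TRset g).ncard + 1) * (j + 1)) y = 0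
    · rw [h0]; exact Nat.zero_le _
    set L := (TRset g).ncard with hL
    have hpos : F^[(L + 1) * (j + 1)] y ≠ 0 := h.iter_nz _ hy
    have hret : g^[(L + 1) * (j + 1)] (toP y) = toP A := by
      rw [← h.toP_iter hg _ hy, toP_eq_iff hpos hA, h.Sn_fac _ hA]
      unfold cnt at h0
      rw [Multiset.countP_eq_zero] at h0
      push Not at h0
      obtain ⟨X, hX, hw⟩ := h0
      exact Multiset.prod_eq_zero (Multiset.mem_map.2 ⟨X, hX, wdg_comm_zero hw⟩)
    obtain ⟨i, hi, hiT⟩ := not_all_TR g hfin (k := (L + 1) * (j + 1)) (by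
      rw [← hL]; nlinarith) hret ha
    have hle : ∏ i ∈ Finset.range (L + 1), ee g d (g^[i] (toP y)) ≤ d ^ L * (d - 1) := by
      rw [← Finset.prod_erase_mul _ _ (Finset.mem_range.2 hi)]
      refine Nat.mul_le_mul ?_ ?_
      · refine (Finset.prod_le_pow_card _ _ d ?_).trans ?_
        · intro x _
          unfold ee
          split_ifs <;> omega
        · rw [Finset.card_erase_of_mem (Finset.mem_range.2 hi)]
          simp [hL]
      · simp [ee, hiT]
    rw [mul_add, mul_one]
    refine (h.cnt_add hg hA _ _ hy).trans ?_
    rw [pow_succ]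
    exact Nat.mul_le_mul (ih (h.iter_nz _ hy)) hle

lemma hcount (h : HomMap F d S1) {g : OnePoint K → OnePoint K}
    (hg : ∀ Z, Z ≠ 0 → toP (F Z) = g (toP Z)) {A : K × K} (hA : A ≠ 0)
    (hfin : (TRset g).Finite)
    (ha : ¬ Set.Finite {z : OnePoint K | ∃ n : ℕ, g^[n] z = toP A}) (c : ℝ) (hc : 0 < c) :
    ∃ k : ℕ, ∃ M : ℕ, (M : ℝ) ≤ c * (d : ℝ) ^ k ∧
      ∀ y, y ≠ 0 → (Sn S1 k A).countP (fun X => wdg X y = 0) ≤ M := by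
  have hd := h.hd
  have hd2 : (2 : ℝ) ≤ d := by exact_mod_cast hd
  obtain ⟨j, hj⟩ := exists_pow_lt_of_lt_one hc (y := ((d : ℝ) - 1) / d)
    (by rw [div_lt_one (by linarith)]; linarith)
  refine ⟨((TRset g).ncard + 1) * j, (d ^ (TRset g).ncard * (d - 1)) ^ j, ?_,
    fun y hy => h.cnt_block hg hA hfin ha j hy⟩
  push_cast [Nat.cast_sub (show 1 ≤ d by omega)]
  rw [pow_mul, pow_succ (d : ℝ), mul_pow, mul_pow, div_pow] at *
  have hdp : (0 : ℝ) < (d : ℝ) ^ j := by positivity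
  rw [div_lt_iff₀ hdp] at hj
  calc _ ≤ ((d : ℝ) ^ (TRset g).ncard) ^ j * (c * (d : ℝ) ^ j) := by gcongr
    _ = _ := by ring

end HomMap

end Counting

section Disc

variable {K}
set_option linter.unusedSectionVars false

lemma ultra_ne {x y : K} (h : ‖y‖ < ‖x‖) : ‖x - y‖ = ‖x‖ := by
  apply le_antisymm
  · exact (ultra_sub x y).trans (max_le le_rfl h.le)
  · have := IsUltrametricDist.norm_add_le_max (x - y) y
    rw [sub_add_cancel] at this
    rcases le_max_iff.1 this with h1 | h1
    · exact h1
    · linarith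

lemma all_one_of_prod (s : Multiset ℝ) (h0 : ∀ x ∈ s, 0 ≤ x) (h1 : ∀ x ∈ s, x ≤ 1)
    (hp : s.prod = 1) : ∀ x ∈ s, x = 1 := by
  intro x hx
  obtain ⟨t, rfl⟩ := Multiset.exists_cons_of_mem hx
  rw [Multiset.prod_cons] at hp
  have ht : t.prod ≤ 1 := by
    have := Multiset.prod_map_le_prod_map₀ (s := t) (fun x => x) (fun _ => (1 : ℝ))
      (fun x hx => h0 x (Multiset.mem_cons_of_mem hx))
      (fun x hx => h1 x (Multiset.mem_cons_of_mem hx))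
    simpa using this
  have hx0 := h0 x hx
  have hx1 := h1 x hx
  nlinarith

lemma generic_unit (B : Multiset K) (hB : ∀ b ∈ B, ‖b‖ ≤ 1) :
    ∃ u : K, ‖u‖ ≤ 1 ∧ ∀ b ∈ B, ‖u - b‖ = 1 := by
  by_cases hB0 : B = 0
  · exact ⟨0, by simp, by simp [hB0]⟩
  set p : K[X] := (B.map (fun b => X - C b)).prod with hp
  have hdeg : p.natDegree = B.card := natDegree_multiset_prod_X_sub_C_eq_card B
  have hcard : 0 < B.card := Multiset.card_pos.2 hB0
  have hdeg' : (p - 1).natDegree = B.card := by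
    rw [← hdeg, ← C_1]; exact natDegree_sub_C
  obtain ⟨u, hu⟩ := IsAlgClosed.exists_root (p - 1) (by
    intro h
    have h2 : (p - 1).natDegree = 0 := natDegree_eq_zero_iff_degree_le_zero.2 h.le
    omega)
  have hu1 : (B.map (fun b => u - b)).prod = 1 := by
    rw [IsRoot.def, eval_sub, eval_one, sub_eq_zero, hp, eval_multiset_prod, Multiset.map_map] at hu
    simpa using hu
  have hu2 : (B.map (fun b => ‖u - b‖)).prod = 1 := by
    have := congrArg norm hu1
    rw [norm_multiset_prod, Multiset.map_map, norm_one] at this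
    exact this
  have hule : ‖u‖ ≤ 1 := by
    by_contra hc
    push Not at hc
    have e : B.map (fun b => ‖u - b‖) = B.map (fun _ => ‖u‖) :=
      Multiset.map_congr rfl (fun b hb => ultra_ne ((hB b hb).trans_lt hc))
    rw [e, Multiset.map_const', Multiset.prod_replicate] at hu2
    have := one_lt_pow₀ hc hcard.ne'
    linarith
  refine ⟨u, hule, fun b hb => ?_⟩
  refine all_one_of_prod _ ?_ ?_ hu2 _ (Multiset.mem_map.2 ⟨b, hb, rfl⟩)
  · intro x hx
    obtain ⟨b, -, rfl⟩ := Multiset.mem_map.1 hx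
    exact norm_nonneg _
  · intro x hx
    obtain ⟨b, hb, rfl⟩ := Multiset.mem_map.1 hx
    exact (ultra_sub _ _).trans (max_le hule (hB b hb))

lemma disc_good (c σ : K) (hσ : σ ≠ 0) :
    GoodSet {Z : K × K | Z.2 = 1 ∧ ‖Z.1 - c‖ ≤ ‖σ‖} := by
  have hσ' : 0 < ‖σ‖ := norm_pos_iff.2 hσ
  constructor
  · intro S
    obtain ⟨u, hu, hub⟩ := generic_unit
      ((S.map (fun X => (X.1 / X.2 - c) / σ)).filter (fun b => ‖b‖ ≤ 1)) (by simp)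
    refine ⟨(c + σ * u, 1), ⟨rfl, ?_⟩, ?_⟩
    · simp only [add_sub_cancel_left, norm_mul]
      nlinarith [norm_nonneg u]
    rintro X hX ⟨w, t⟩ ⟨ht, hw⟩
    simp only at ht hw
    subst ht
    unfold wdg
    simp only [one_mul]
    by_cases hX2 : X.2 = 0
    · simp [hX2]
    have e : ∀ w : K, w * X.2 - X.1 = ((w - c) - (X.1 / X.2 - c)) * X.2 := by
      intro w; field_simp; ring
    rw [e, e, norm_mul, norm_mul]
    refine mul_le_mul_of_nonneg_right ?_ (norm_nonneg _)
    rw [add_sub_cancel_left]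
    set γ := X.1 / X.2 - c with hγ
    by_cases hle : ‖γ‖ ≤ ‖σ‖
    · have hb : ‖u - γ / σ‖ = 1 := by
        apply hub
        rw [Multiset.mem_filter, Multiset.mem_map]
        refine ⟨⟨X, hX, rfl⟩, ?_⟩
        rw [norm_div, div_le_one hσ']; exact hle
      have e2 : σ * u - γ = σ * (u - γ / σ) := by field_simp
      rw [e2, norm_mul, hb, mul_one]
      exact (ultra_sub _ _).trans (max_le hw hle)
    · push Not at hle
      have hsu : ‖σ * u‖ < ‖γ‖ := by
        rw [norm_mul]; nlinarith [norm_nonneg u]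
      rw [norm_sub_rev (σ * u), ultra_ne hsu]
      exact (ultra_sub _ _).trans (max_le (hw.trans hle.le) le_rfl)
  · intro X hX
    by_cases h1 : wdg (c, 1) X = 0
    · refine ⟨(c + σ, 1), ⟨rfl, by simp⟩, fun h2 => hX ?_⟩
      simp only [wdg, one_mul] at h1 h2
      have h3 : σ * X.2 = 0 := by linear_combination h2 - h1
      have h4 : X.2 = 0 := by simpa [hσ] using h3
      refine Prod.ext ?_ h4
      rw [h4] at h1
      simpa using h1
    · exact ⟨(c, 1), ⟨rfl, by simp⟩, h1⟩

end Disc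

section Lift

variable {K}
set_option linter.unusedSectionVars false

/-- Homogenisation of a polynomial in degree `d`. -/
noncomputable def hom (H : K[X]) (d : ℕ) (Z : K × K) : K :=
  ∑ i ∈ Finset.range (d + 1), H.coeff i * Z.1 ^ i * Z.2 ^ (d - i)

lemma hom_of_ne {H : K[X]} {d : ℕ} (hH : H.natDegree ≤ d) {Z : K × K} (hZ : Z.2 ≠ 0) :
    hom H d Z = Z.2 ^ d * H.eval (Z.1 / Z.2) := by
  rw [eval_eq_sum_range' (Nat.lt_succ_of_le hH), hom, Finset.mul_sum]
  refine Finset.sum_congr rfl fun i hi => ?_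
  have hid : i ≤ d := Nat.lt_succ_iff.1 (Finset.mem_range.1 hi)
  rw [div_pow, ← Nat.sub_add_cancel hid, pow_add, Nat.sub_add_cancel hid]
  field_simp

lemma hom_of_zero {H : K[X]} {d : ℕ} {Z : K × K} (hZ : Z.2 = 0) :
    hom H d Z = H.coeff d * Z.1 ^ d := by
  rw [hom, Finset.sum_range_succ, Finset.sum_eq_zero]
  · simp
  · intro i hi
    have : d - i ≠ 0 := by have := Finset.mem_range.1 hi; omega
    simp [hZ, this]

lemma hom_factor {H : K[X]} {d : ℕ} (hd : 1 ≤ d) (hH : H.natDegree ≤ d) (h0 : H ≠ 0) :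
    ∃ S : Multiset (K × K), S.card = d ∧ (∀ X ∈ S, X ≠ 0) ∧
      ∀ Z, hom H d Z = (S.map (wdg Z)).prod := by
  have hsp := IsAlgClosed.splits H
  have hcard : H.roots.card = H.natDegree := hsp.natDegree_eq_card_roots.symm
  have hHe : ∀ t, H.eval t = H.leadingCoeff * (H.roots.map (fun a => t - a)).prod := by
    intro t
    conv_lhs => rw [hsp.eq_prod_roots]
    rw [eval_mul, eval_C, eval_multiset_prod, Multiset.map_map]
    simp
  set S0 : Multiset (K × K) := H.roots.map (fun a => (a, (1 : K))) +
    Multiset.replicate (d - H.natDegree) ((-1 : K), (0 : K)) with hS0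
  have hc0 : S0.card = d := by
    rw [hS0, Multiset.card_add, Multiset.card_map, Multiset.card_replicate, hcard]; omega
  have hnz : ∀ X ∈ S0, X ≠ 0 := by
    intro X hX
    rw [hS0, Multiset.mem_add] at hX
    rcases hX with hX | hX
    · obtain ⟨a, -, rfl⟩ := Multiset.mem_map.1 hX
      simp
    · rw [Multiset.eq_of_mem_replicate hX]; simp
  have hprod : ∀ Z, hom H d Z = H.leadingCoeff * (S0.map (wdg Z)).prod := by
    intro Z
    rw [hS0, Multiset.map_add, Multiset.prod_add, Multiset.map_map, Multiset.map_replicate,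
      Multiset.prod_replicate]
    by_cases hZ : Z.2 = 0
    · rw [hom_of_zero hZ]
      have e1 : (H.roots.map (wdg Z ∘ fun a => (a, (1 : K)))).prod = Z.1 ^ H.natDegree := by
        rw [← hcard, ← Multiset.prod_replicate, ← Multiset.map_const']
        congr 1
        refine Multiset.map_congr rfl fun a _ => ?_
        simp [wdg, hZ]
      rw [e1]
      rcases hH.eq_or_lt with h | h
      · rw [← h]; simp
      · rw [coeff_eq_zero_of_natDegree_lt h]
        have : d - H.natDegree ≠ 0 := by omega
        simp [wdg, hZ, this]
    · rw [hom_of_ne hH hZ, hHe]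
      have e1 : (H.roots.map (wdg Z ∘ fun a => (a, (1 : K)))).prod =
          Z.2 ^ H.natDegree * (H.roots.map (fun a => Z.1 / Z.2 - a)).prod := by
        rw [← hcard, ← Multiset.prod_replicate, ← Multiset.map_const', ← Multiset.prod_map_mul]
        congr 1
        refine Multiset.map_congr rfl fun a _ => ?_
        simp [wdg]
        field_simp
      have e2 : wdg Z ((-1 : K), (0 : K)) = Z.2 := by simp [wdg]
      rw [e1, e2, ← Nat.sub_add_cancel hH, pow_add, Nat.sub_add_cancel hH]
      ring
  have hpos : 0 < S0.card := by omega
  obtain ⟨x, hx⟩ := Multiset.card_pos_iff_exists_mem.1 hpos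
  obtain ⟨t, ht⟩ := Multiset.exists_cons_of_mem hx
  have hl : H.leadingCoeff ≠ 0 := leadingCoeff_ne_zero.2 h0
  refine ⟨(H.leadingCoeff • x) ::ₘ t, ?_, ?_, ?_⟩
  · rw [ht, Multiset.card_cons] at hc0
    rw [Multiset.card_cons, hc0]
  · intro X hX
    rcases Multiset.mem_cons.1 hX with rfl | hX
    · exact smul_ne_zero hl (hnz x hx)
    · exact hnz X (by rw [ht]; exact Multiset.mem_cons_of_mem hX)
  · intro Z
    rw [hprod, ht, Multiset.map_cons, Multiset.map_cons, Multiset.prod_cons, Multiset.prod_cons,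
      ← mul_assoc]
    congr 1
    simp [wdg]; ring

/-- The homogeneous lift. -/
noncomputable def Fmap (f : RatFunc K) (Z : K × K) : K × K :=
  (hom f.num (rdeg K f) Z, hom f.denom (rdeg K f) Z)

lemma num_le (f : RatFunc K) : f.num.natDegree ≤ rdeg K f := le_max_left _ _
lemma denom_le (f : RatFunc K) : f.denom.natDegree ≤ rdeg K f := le_max_right _ _

lemma no_common_root (f : RatFunc K) (t : K) (h1 : f.num.eval t = 0) (h2 : f.denom.eval t = 0) :
    False := by
  obtain ⟨u, v, huv⟩ := f.isCoprime_num_denom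
  have := congrArg (eval t) huv
  simp [h1, h2] at this

lemma top_coeff (f : RatFunc K) (hd : 1 < rdeg K f) :
    ¬ (f.num.coeff (rdeg K f) = 0 ∧ f.denom.coeff (rdeg K f) = 0) := by
  rintro ⟨h1, h2⟩
  rcases max_choice f.num.natDegree f.denom.natDegree with h | h
  · have e : rdeg K f = f.num.natDegree := h
    rw [e] at h1 hd
    have : f.num = 0 := leadingCoeff_eq_zero.1 h1
    rw [this] at hd; simp at hd
  · have e : rdeg K f = f.denom.natDegree := h
    rw [e] at h2
    exact f.denom_ne_zero (leadingCoeff_eq_zero.1 h2)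

lemma Fmap_nz (f : RatFunc K) (hd : 1 < rdeg K f) (Z : K × K) (hZ : Z ≠ 0) : Fmap f Z ≠ 0 := by
  intro h
  have h1 : hom f.num (rdeg K f) Z = 0 := congrArg Prod.fst h
  have h2 : hom f.denom (rdeg K f) Z = 0 := congrArg Prod.snd h
  by_cases hz : Z.2 = 0
  · have hz1 : Z.1 ≠ 0 := fun h => hZ (Prod.ext h hz)
    rw [hom_of_zero hz] at h1 h2
    have hp := pow_ne_zero (rdeg K f) hz1
    exact top_coeff f hd ⟨by simpa [hz1] using h1, by simpa [hz1] using h2⟩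
  · rw [hom_of_ne (num_le f) hz] at h1
    rw [hom_of_ne (denom_le f) hz] at h2
    exact no_common_root f _ (by simpa [hz] using h1) (by simpa [hz] using h2)

lemma pencil_ne (f : RatFunc K) (hd : 1 < rdeg K f) (A : K × K) (hA : A ≠ 0) :
    C A.2 * f.num - C A.1 * f.denom ≠ 0 := by
  intro h
  by_cases h2 : A.2 = 0
  · have h1 : A.1 ≠ 0 := fun h => hA (Prod.ext h h2)
    rw [h2] at h
    simp [h1, f.denom_ne_zero] at h
  · have hdv : f.denom ∣ f.num := by
      refine ⟨C (A.1 / A.2), ?_⟩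
      have : C A.2 * f.num = C A.1 * f.denom := sub_eq_zero.1 h
      have h3 : f.num = C (A.2⁻¹) * (C A.2 * f.num) := by
        rw [← mul_assoc, ← C_mul, inv_mul_cancel₀ h2, C_1, one_mul]
      rw [h3, this, ← mul_assoc, ← C_mul, mul_comm]
      congr 2; field_simp
    have hu : IsUnit f.denom := f.isCoprime_num_denom.isUnit_of_dvd' hdv dvd_rfl
    have hq : f.denom.natDegree = 0 := natDegree_eq_zero_of_isUnit hu
    obtain ⟨c, hc⟩ := natDegree_eq_zero.1 hq
    have : C A.2 * f.num = C A.1 * f.denom := sub_eq_zero.1 h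
    have hn : f.num.natDegree = 0 := by
      rw [← natDegree_C_mul (p := f.num) h2, this, ← hc, ← C_mul, natDegree_C]
    unfold rdeg at hd
    omega

lemma wdg_Fmap (f : RatFunc K) (A Z : K × K) :
    wdg (Fmap f Z) A = hom (C A.2 * f.num - C A.1 * f.denom) (rdeg K f) Z := by
  simp only [wdg, Fmap, hom, Finset.sum_mul, ← Finset.sum_sub_distrib, coeff_sub, coeff_C_mul]
  refine Finset.sum_congr rfl fun i _ => ?_
  ring

lemma exists_homMap (f : RatFunc K) (hd : 1 < rdeg K f) :
    ∃ S1, HomMap (Fmap f) (rdeg K f) S1 := by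
  have : ∀ A : K × K, ∃ S : Multiset (K × K), A ≠ 0 → S.card = rdeg K f ∧ (∀ X ∈ S, X ≠ 0) ∧
      ∀ Z, wdg (Fmap f Z) A = (S.map (wdg Z)).prod := by
    intro A
    by_cases hA : A = 0
    · exact ⟨0, fun h => absurd hA h⟩
    · obtain ⟨S, h1, h2, h3⟩ := hom_factor (d := rdeg K f) (by omega)
        (H := C A.2 * f.num - C A.1 * f.denom)
        ((natDegree_sub_le _ _).trans (max_le
          ((natDegree_C_mul_le _ _).trans (num_le f)) ((natDegree_C_mul_le _ _).trans (denom_le f))))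
        (pencil_ne f hd A hA)
      exact ⟨S, fun _ => ⟨h1, h2, fun Z => by rw [wdg_Fmap, h3]⟩⟩
  choose S1 hS1 using this
  exact ⟨S1, hd, Fmap_nz f hd, fun A hA => (hS1 A hA).1, fun A hA => (hS1 A hA).2.1,
    fun A hA => (hS1 A hA).2.2⟩

lemma evalP1_infty (f : RatFunc K) : evalP1 K f OnePoint.infty =
    if f.denom.natDegree < f.num.natDegree then OnePoint.infty
      else ((f.num.coeff f.denom.natDegree / f.denom.leadingCoeff : K) : OnePoint K) := rfl

lemma evalP1_coe (f : RatFunc K) (a : K) : evalP1 K f (a : OnePoint K) =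
    if f.denom.eval a = 0 then OnePoint.infty
      else ((f.num.eval a / f.denom.eval a : K) : OnePoint K) := rfl

lemma toP_Fmap (f : RatFunc K) (Z : K × K) (hZ : Z ≠ 0) :
    toP (Fmap f Z) = evalP1 K f (toP Z) := by
  by_cases hz : Z.2 = 0
  · have hz1 : Z.1 ≠ 0 := fun h => hZ (Prod.ext h hz)
    have e : toP Z = OnePoint.infty := by simp [toP, hz]
    rw [e, evalP1_infty, toP, Fmap]
    simp only [hom_of_zero hz]
    have hp := pow_ne_zero (rdeg K f) hz1
    split_ifs with h1 h2 h2
    · rfl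
    · push Not at h2
      have e : rdeg K f = f.denom.natDegree := max_eq_right h2
      rw [e] at h1
      exfalso
      have : f.denom.leadingCoeff = 0 := by simpa [hz1] using h1
      exact f.denom_ne_zero (leadingCoeff_eq_zero.1 this)
    · have e : rdeg K f = f.num.natDegree := max_eq_left h2.le
      exact absurd (by rw [coeff_eq_zero_of_natDegree_lt (by rw [e]; exact h2)]; simp) h1
    · push Not at h2
      have e : rdeg K f = f.denom.natDegree := max_eq_right h2
      rw [mul_div_mul_right _ _ hp, e]
      rfl
  · have e : toP Z = ((Z.1 / Z.2 : K) : OnePoint K) := by simp [toP, hz]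
    rw [e, evalP1_coe, toP, Fmap]
    simp only [hom_of_ne (num_le f) hz, hom_of_ne (denom_le f) hz]
    have hp := pow_ne_zero (rdeg K f) hz
    rw [mul_div_mul_left _ _ hp]
    simp [hz]

lemma chordal_eq (x y : OnePoint K) : chordal K x y =
    ‖wdg (homCoord K x) (homCoord K y)‖ / (‖homCoord K x‖ * ‖homCoord K y‖) := by
  rw [chordal, wdg, Prod.norm_def, Prod.norm_def]

lemma exists_smul_homCoord (Z : K × K) (hZ : Z ≠ 0) :
    ∃ c : K, c ≠ 0 ∧ Z = c • homCoord K (toP Z) := by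
  by_cases hz : Z.2 = 0
  · have hz1 : Z.1 ≠ 0 := fun h => hZ (Prod.ext h hz)
    refine ⟨Z.1, hz1, ?_⟩
    have e : toP Z = OnePoint.infty := by simp [toP, hz]
    rw [e, homCoord_infty]
    ext <;> simp [hz]
  · refine ⟨Z.2, hz, ?_⟩
    have e : toP Z = ((Z.1 / Z.2 : K) : OnePoint K) := by simp [toP, hz]
    rw [e, homCoord_coe]
    ext
    · simp; field_simp
    · simp

lemma chordal_toP (Z : K × K) (hZ : Z ≠ 0) (y : OnePoint K) : chordal K (toP Z) y =
    ‖wdg Z (homCoord K y)‖ / (‖Z‖ * ‖homCoord K y‖) := by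
  obtain ⟨c, hc, e⟩ := exists_smul_homCoord Z hZ
  rw [chordal_eq]
  have e1 : wdg Z (homCoord K y) = c * wdg (homCoord K (toP Z)) (homCoord K y) := by
    conv_lhs => rw [e]
    simp [wdg]; ring
  have e2 : ‖Z‖ = ‖c‖ * ‖homCoord K (toP Z)‖ := by
    conv_lhs => rw [e]
    rw [norm_smul]
  rw [e1, e2, norm_mul, mul_assoc, mul_div_mul_left _ _ (norm_ne_zero_iff.2 hc)]

lemma chordal_le_one (x y : OnePoint K) : chordal K x y ≤ 1 := by
  rw [chordal_eq]
  exact div_le_one_of_le₀ (norm_wdg_le _ _) (by positivity)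

lemma exists_disc (D : Set (OnePoint K)) (hD : IsOpen D) (hDne : D.Nonempty) :
    ∃ c σ : K, σ ≠ 0 ∧ ∀ w : K, ‖w - c‖ ≤ ‖σ‖ → (w : OnePoint K) ∈ D := by
  have : NoncompactSpace K := NormedSpace.noncompactSpace K K
  obtain ⟨c, hc⟩ := (OnePoint.denseRange_coe (X := K)).exists_mem_open hD hDne
  have hO : IsOpen ((fun x : K => (x : OnePoint K)) ⁻¹' D) := hD.preimage OnePoint.continuous_coe
  obtain ⟨r, hr, hb⟩ := Metric.isOpen_iff.1 hO c hc
  obtain ⟨σ, hσ, hσr⟩ := NormedField.exists_norm_lt K hr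
  refine ⟨c, σ, norm_pos_iff.1 hσ, fun w hw => hb ?_⟩
  rw [Metric.mem_ball, dist_eq_norm]
  exact hw.trans_lt hσr

lemma final_of_TR (f : RatFunc K)
    (hd : 1 < rdeg K f) (hTR : (TRset (evalP1 K f)).Finite)
    (a : OnePoint K) (ha : a ∉ exceptionalSet K f)
    (D : Set (OnePoint K)) (hD : IsOpen D) (hDne : D.Nonempty) :
    ∀ ε : ℝ, 0 < ε → ∀ᶠ n : ℕ in atTop,
      (∀ w ∈ D, chordal K ((evalP1 K f)^[n] w) a ≤ Real.exp (ε * (rdeg K f : ℝ) ^ n)) ∧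
      ∃ w ∈ D, Real.exp (-ε * (rdeg K f : ℝ) ^ n) ≤ chordal K ((evalP1 K f)^[n] w) a := by
  intro ε hε
  obtain ⟨S1, h⟩ := exists_homMap f hd
  obtain ⟨c, σ, hσ, hdisc⟩ := exists_disc D hD hDne
  have hA := homCoord_ne a
  have hg := toP_Fmap f
  have hT := disc_good c σ hσ
  have ha' : ¬ Set.Finite {z : OnePoint K | ∃ n : ℕ, (evalP1 K f)^[n] z = toP (homCoord K a)} := by
    rw [toP_hom]; exact ha
  have hm := h.main_abstract hA (h.hcount hg hA hTR ha') hT (ε / 2) (by linarith)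
  have hApos : 0 < ‖homCoord K a‖ := norm_pos_iff.2 hA
  have hlim : Tendsto (fun n : ℕ => (rdeg K f : ℝ) ^ n) atTop atTop :=
    tendsto_pow_atTop_atTop_of_one_lt (by exact_mod_cast hd)
  have hev := hlim.eventually_ge_atTop (Real.log ‖homCoord K a‖ / (ε / 2))
  filter_upwards [hm, hev] with n hn hen
  constructor
  · intro w _
    exact (chordal_le_one _ _).trans (Real.one_le_exp (by positivity))
  · have hTn := h.iter_good n hT
    obtain ⟨Z, ⟨W, hW, rfl⟩, hZ⟩ := hTn.exists_nu {homCoord K a}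
    have hZ' := hZ (homCoord K a) (by simp)
    obtain ⟨hW2, hW1⟩ := hW
    have hW0 : W ≠ 0 := by
      intro h; rw [h] at hW2; simp at hW2
    have htoP : toP W = (W.1 : OnePoint K) := by simp [toP, hW2]
    refine ⟨W.1, hdisc _ hW1, ?_⟩
    rw [← htoP, ← h.toP_iter hg n hW0, chordal_toP _ (h.iter_nz n hW0), hZ', ← div_div]
    have hle := hTn.le_NN ⟨W, ⟨hW2, hW1⟩, rfl⟩
    have hnz : 0 < ‖(Fmap f)^[n] W‖ := norm_pos_iff.2 (h.iter_nz n hW0)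
    rw [le_div_iff₀ hApos]
    have h1 : Real.exp (-ε * (rdeg K f : ℝ) ^ n) * ‖homCoord K a‖ ≤
        Real.exp (-(ε / 2) * (rdeg K f : ℝ) ^ n) := by
      have hx : ‖homCoord K a‖ = Real.exp (Real.log ‖homCoord K a‖) := (Real.exp_log hApos).symm
      rw [hx, ← Real.exp_add, Real.exp_le_exp]
      rw [div_le_iff₀ (by linarith)] at hen
      linarith
    refine h1.trans (hn.trans ?_)
    unfold RR
    exact div_le_div_of_nonneg_left (hTn.nu_pos hA).le hnz hle

end Lift

section TotallyRamified

variable {K}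
set_option linter.unusedSectionVars false

lemma TR_poly (f : RatFunc K) (hd : 1 < rdeg K f) {x : K}
    (hx : (x : OnePoint K) ∈ TRset (evalP1 K f)) (hQ : f.denom.eval x ≠ 0) :
    ∃ v c : K, c ≠ 0 ∧ f.num - C v * f.denom = C c * (X - C x) ^ (rdeg K f) := by
  set v : K := f.num.eval x / f.denom.eval x with hv
  set H : K[X] := f.num - C v * f.denom with hH
  have hvx : evalP1 K f (x : OnePoint K) = (v : OnePoint K) := by
    rw [evalP1_coe, if_neg hQ]
  have hA : ((v, 1) : K × K) ≠ 0 := by simp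
  have hHp : H = C ((v, (1 : K)) : K × K).2 * f.num - C ((v, (1 : K)) : K × K).1 * f.denom := by
    simp [hH]
  have hH0 : H ≠ 0 := by rw [hHp]; exact pencil_ne f hd _ hA
  have hle : H.natDegree ≤ rdeg K f :=
    (natDegree_sub_le _ _).trans (max_le (num_le f) ((natDegree_C_mul_le _ _).trans (denom_le f)))
  have key : ∀ Z : K × K, Z ≠ 0 → hom H (rdeg K f) Z = 0 → toP Z = (x : OnePoint K) := by
    intro Z hZ h0
    apply hx
    rw [hHp, ← wdg_Fmap, ← toP_eq_iff (Fmap_nz f hd Z hZ) hA, toP_Fmap f Z hZ] at h0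
    rw [h0, hvx]
    simp [toP]
  have hdeg : H.natDegree = rdeg K f := by
    refine le_antisymm hle (le_natDegree_of_ne_zero fun h0 => ?_)
    have := key (1, 0) (by simp) (by rw [hom_of_zero rfl, h0]; simp)
    simp [toP] at this
  have hroot : ∀ b ∈ H.roots, b = x := by
    intro b hb
    have hb' : H.eval b = 0 := (mem_roots hH0).1 hb
    have := key (b, 1) (by simp) (by rw [hom_of_ne hle (by simp)]; simp [hb'])
    simpa [toP] using this
  have hsp := IsAlgClosed.splits H
  have hcard : H.roots.card = H.natDegree := hsp.natDegree_eq_card_roots.symm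
  have hrep : H.roots = Multiset.replicate (rdeg K f) x :=
    Multiset.eq_replicate.2 ⟨hcard.trans hdeg, hroot⟩
  refine ⟨v, H.leadingCoeff, leadingCoeff_ne_zero.2 hH0, ?_⟩
  have := hsp.eq_prod_roots
  rw [hrep] at this
  simpa using this

lemma choose_zero (f : RatFunc K) (hd : 1 < rdeg K f)
    (hinf : {x : K | (x : OnePoint K) ∈ TRset (evalP1 K f) ∧ f.denom.eval x ≠ 0}.Infinite)
    (i : ℕ) (hi : 0 < i) (hid : i < rdeg K f) : ((rdeg K f).choose i : K) = 0 := by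
  by_contra hne
  set T := {x : K | (x : OnePoint K) ∈ TRset (evalP1 K f) ∧ f.denom.eval x ≠ 0} with hT
  set d := rdeg K f with hdd
  obtain ⟨x, hx⟩ := hinf.nonempty
  obtain ⟨y, hy, hyx⟩ := hinf.exists_notMem_finset {x}
  have hyx' : y - x ≠ 0 := sub_ne_zero.2 (by simpa using hyx)
  have hp0 : (X ^ i - C ((y - x) ^ i) : K[X]) ≠ 0 := X_pow_sub_C_ne_zero hi _
  obtain ⟨w, hw, hwx⟩ := hinf.exists_notMem_finset
    ({x, y} ∪ ((X ^ i - C ((y - x) ^ i) : K[X]).roots.toFinset.image (fun t => t + x)))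
  simp only [Finset.mem_union, Finset.mem_insert, Finset.mem_singleton, Finset.mem_image,
    Multiset.mem_toFinset, not_or, not_exists, not_and] at hwx
  obtain ⟨⟨hwx1, hwy⟩, hwr⟩ := hwx
  have hwx' : w - x ≠ 0 := sub_ne_zero.2 hwx1
  obtain ⟨vx, cx, hcx, ex⟩ := TR_poly f hd hx.1 hx.2
  obtain ⟨vy, cy, hcy, ey⟩ := TR_poly f hd hy.1 hy.2
  obtain ⟨vw, cw, hcw, ew⟩ := TR_poly f hd hw.1 hw.2
  rw [← hdd] at ex ey ew
  have hd0 : d ≠ 0 := by omega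
  have hvne : ∀ {a b va vb ca cb : K}, ca ≠ 0 → a ≠ b →
      f.num - C va * f.denom = C ca * (X - C a) ^ d →
      f.num - C vb * f.denom = C cb * (X - C b) ^ d → vb - va ≠ 0 := by
    intro a b va vb ca cb hca hab e1 e2 h
    have : vb = va := sub_eq_zero.1 h
    rw [this, e1] at e2
    have := congrArg (eval b) e2
    simp [hd0, hca] at this
    exact hab (sub_eq_zero.1 this).symm
  have hvy : vy - vx ≠ 0 := hvne hcx (by simpa using fun h : x = y => hyx (by simp [h])) ex ey
  have hvw : vw - vx ≠ 0 := hvne hcx (fun h => hwx1 h.symm) ex ew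
  have rel : C ((vy - vx) * cx - (vw - vx) * cx) * (X - C x) ^ d +
      C (-(vy - vx) * cw) * (X - C w) ^ d + C ((vw - vx) * cy) * (X - C y) ^ d = 0 := by
    simp only [C_mul, C_sub, C_neg] at *
    linear_combination (C vw - C vx) * (ex - ey) + (C vy - C vx) * (ew - ex)
  have rel2 := congrArg (fun p => p.comp (X + C x)) rel
  have hcoef : ∀ j, j < d → (d.choose j : K) ≠ 0 →
      (vy - vx) * cw * (-(w - x)) ^ (d - j) = (vw - vx) * cy * (-(y - x)) ^ (d - j) := by
    intro j hj hjn
    have e := congrArg (fun p => coeff p j) rel2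
    have hcomp : ∀ z : K, ((X : K[X]) - C z).comp (X + C x) = X - C (z - x) := by
      intro z; simp only [sub_comp, X_comp, C_comp, C_sub]; ring
    have hcf : ∀ z : K, (((X : K[X]) - C z) ^ d).coeff j = (-z) ^ (d - j) * (d.choose j : K) := by
      intro z
      rw [sub_eq_add_neg, ← C_neg, coeff_X_add_C_pow]
    simp only [add_comp, mul_comp, C_comp, pow_comp, hcomp, zero_comp, coeff_add, coeff_C_mul,
      hcf, coeff_zero, sub_self, neg_zero, zero_pow (Nat.sub_ne_zero_of_lt hj)] at e
    have e' : (d.choose j : K) * ((vw - vx) * cy * (-(y - x)) ^ (d - j) -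
      (vy - vx) * cw * (-(w - x)) ^ (d - j)) = 0 := by linear_combination e
    exact (sub_eq_zero.1 ((mul_eq_zero.1 e').resolve_left hjn)).symm
  have e0 := hcoef 0 (by omega) (by simp)
  have ei := hcoef i hid hne
  rw [Nat.sub_zero] at e0
  have hsplit : ∀ z : K, z ^ d = z ^ (d - i) * z ^ i := by
    intro z; rw [← pow_add, Nat.sub_add_cancel hid.le]
  rw [hsplit, hsplit (-(y - x))] at e0
  have e1 : ((vy - vx) * cw * (-(w - x)) ^ (d - i)) * ((-(w - x)) ^ i - (-(y - x)) ^ i) = 0 := by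
    linear_combination e0 - (-(y - x)) ^ i * ei
  have e2 : (-(w - x)) ^ i - (-(y - x)) ^ i = 0 := by
    refine (mul_eq_zero.1 e1).resolve_left ?_
    exact mul_ne_zero (mul_ne_zero hvy hcw) (pow_ne_zero _ (neg_ne_zero.2 hwx'))
  have e3 : (w - x) ^ i = (y - x) ^ i := by
    rw [neg_pow, neg_pow (y - x), ← mul_sub] at e2
    exact sub_eq_zero.1 ((mul_eq_zero.1 e2).resolve_left (pow_ne_zero _ (by simp)))
  refine hwr (w - x) ?_ (by ring)
  rw [mem_roots hp0]
  simp [e3]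

lemma add_pow_of_choose {R : Type*} [CommRing R] {d : ℕ} (hd : 0 < d)
    (h : ∀ i, 0 < i → i < d → (d.choose i : R) = 0) (a b : R) : (a + b) ^ d = a ^ d + b ^ d := by
  obtain ⟨e, rfl⟩ : ∃ e, d = e + 1 := ⟨d - 1, by omega⟩
  rw [add_pow, Finset.sum_range_succ, Finset.sum_range_succ', Finset.sum_eq_zero]
  · simp; ring
  · intro i hi
    rw [h (i + 1) (by omega) (by have := Finset.mem_range.1 hi; omega)]
    simp

lemma binomial_form (f : RatFunc K) (hd : 1 < rdeg K f)
    (hinf : {x : K | (x : OnePoint K) ∈ TRset (evalP1 K f) ∧ f.denom.eval x ≠ 0}.Infinite) :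
    ∃ α β γ δ : K, f.num = C α * X ^ (rdeg K f) + C β ∧ f.denom = C γ * X ^ (rdeg K f) + C δ := by
  have hch := choose_zero f hd hinf
  obtain ⟨x, hx⟩ := hinf.nonempty
  obtain ⟨y, hy, hyx⟩ := hinf.exists_notMem_finset {x}
  obtain ⟨vx, cx, hcx, ex⟩ := TR_poly f hd hx.1 hx.2
  obtain ⟨vy, cy, hcy, ey⟩ := TR_poly f hd hy.1 hy.2
  set d := rdeg K f with hdd
  have hd0 : d ≠ 0 := by omega
  have hfr : ∀ z : K, ((X : K[X]) - C z) ^ d = X ^ d + C ((-z) ^ d) := by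
    intro z
    rw [sub_eq_add_neg, ← C_neg, add_pow_of_choose (by omega), C_pow]
    intro i h1 h2
    have := congrArg C (hch i h1 h2)
    simpa using this
  have hvy : vy - vx ≠ 0 := by
    intro h
    have : vy = vx := sub_eq_zero.1 h
    rw [this, ex] at ey
    have := congrArg (eval y) ey
    simp [hd0, hcx] at this
    exact hyx (by simp [sub_eq_zero.1 this])
  rw [hfr] at ex ey
  have hQ : f.denom = C ((cx - cy) / (vy - vx)) * X ^ d +
      C ((cx * (-x) ^ d - cy * (-y) ^ d) / (vy - vx)) := by
    have e : C (vy - vx) * f.denom = C (cx - cy) * X ^ d + C (cx * (-x) ^ d - cy * (-y) ^ d) := by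
      simp only [C_mul, C_sub]
      linear_combination ex - ey
    have e2 : f.denom = C ((vy - vx)⁻¹) * (C (vy - vx) * f.denom) := by
      rw [← mul_assoc, ← C_mul, inv_mul_cancel₀ hvy, C_1, one_mul]
    rw [e2, e, mul_add, ← mul_assoc, ← C_mul, ← C_mul, inv_mul_eq_div, inv_mul_eq_div]
  generalize (cx - cy) / (vy - vx) = γ at hQ
  generalize (cx * (-x) ^ d - cy * (-y) ^ d) / (vy - vx) = δ at hQ
  refine ⟨vx * γ + cx, vx * δ + cx * (-x) ^ d, γ, δ, ?_, hQ⟩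
  rw [hQ] at ex
  simp only [C_mul, C_add] at *
  linear_combination ex

lemma ratfunc_cross (h : RatFunc K) {N D : K[X]} (hD : D ≠ 0)
    (e : h = algebraMap K[X] (RatFunc K) N / algebraMap K[X] (RatFunc K) D) :
    h.num * D = N * h.denom := by
  have hD' : algebraMap K[X] (RatFunc K) D ≠ 0 := RatFunc.algebraMap_ne_zero hD
  have hd' : algebraMap K[X] (RatFunc K) h.denom ≠ 0 := RatFunc.algebraMap_ne_zero h.denom_ne_zero
  have e2 : algebraMap K[X] (RatFunc K) h.num / algebraMap K[X] (RatFunc K) h.denom =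
      algebraMap K[X] (RatFunc K) N / algebraMap K[X] (RatFunc K) D := by
    rw [RatFunc.num_div_denom, ← e]
  rw [div_eq_div_iff hd' hD', ← map_mul, ← map_mul] at e2
  exact RatFunc.algebraMap_injective K e2

lemma rdeg_eq (h : RatFunc K) {N D : K[X]} (hD : D ≠ 0) (hc : IsCoprime N D)
    (e : h = algebraMap K[X] (RatFunc K) N / algebraMap K[X] (RatFunc K) D) :
    rdeg K h = max N.natDegree D.natDegree := by
  have cr := ratfunc_cross h hD e
  have hcop := h.isCoprime_num_denom
  have d1 : D ∣ h.denom := hc.symm.dvd_of_dvd_mul_left ⟨h.num, by rw [← cr, mul_comm]⟩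
  have d2 : h.denom ∣ D := hcop.symm.dvd_of_dvd_mul_left ⟨N, by rw [cr, mul_comm]⟩
  have d3 : N ∣ h.num := hc.dvd_of_dvd_mul_right ⟨h.denom, cr⟩
  have d4 : h.num ∣ N := hcop.dvd_of_dvd_mul_right ⟨D, cr.symm⟩
  rw [rdeg, natDegree_eq_natDegree (degree_eq_degree_of_associated (associated_of_dvd_dvd d4 d3)),
    natDegree_eq_natDegree (degree_eq_degree_of_associated (associated_of_dvd_dvd d2 d1))]

lemma rcomp_eq (h g : RatFunc K) {N D : K[X]}
    (e : h = algebraMap K[X] (RatFunc K) N / algebraMap K[X] (RatFunc K) D)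
    (hg : aeval g D ≠ 0) : rcomp K h g = aeval g N / aeval g D := by
  have hD : D ≠ 0 := by rintro rfl; simp at hg
  have cr := ratfunc_cross h hD e
  have d2 : h.denom ∣ D :=
    h.isCoprime_num_denom.symm.dvd_of_dvd_mul_left ⟨N, by rw [cr, mul_comm]⟩
  have hden : aeval g h.denom ≠ 0 := by
    obtain ⟨q, hq⟩ := d2
    intro h0
    rw [hq, map_mul, h0, zero_mul] at hg
    exact hg rfl
  have : rcomp K h g = aeval g h.num / aeval g h.denom := rfl
  rw [this, div_eq_div_iff hden hg, ← map_mul, ← map_mul, cr]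


lemma good_red_contra (f : RatFunc K) (φ ψ : RatFunc K) (hφ : rdeg K φ = 1) (hψ : rdeg K ψ = 1)
    (hφψ : rcomp K φ ψ = RatFunc.X) (d : ℕ) (hd : rdeg K f = d)
    (hconj : rcomp K (rcomp K φ f) ψ = RatFunc.X ^ d)
    (hf : NoPotentiallyGoodReductions K f) : False := by
  have hX : toK K (X ^ d) = X ^ d := by simp [toK]
  have h1 : toK K 1 = 1 := by simp [toK]
  have hrd : rdeg K (RatFunc.X ^ d : RatFunc K) = d := by
    rw [rdeg_eq (RatFunc.X ^ d : RatFunc K) (N := X ^ d) (D := 1) one_ne_zero isCoprime_one_right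
      (by simp)]
    simp
  have := hf φ ψ hφ hψ hφψ (X ^ d) 1 (by
    rw [hconj]
    refine ⟨?_, ?_, ?_, ?_, 0, Or.inr ?_⟩
    · rw [h1]; exact one_ne_zero
    · rw [h1]; exact isCoprime_one_right
    · rw [h1, hX, hrd]; simp
    · rw [h1, hX]; simp
    · simp)
  have hnt : Nontrivial (residueRing K) := by
    apply Ideal.Quotient.nontrivial_iff.2
    intro htop
    have h : (1 : intRing K) ∈ maxIdeal K := by rw [htop]; trivial
    have h' : ‖((1 : intRing K) : K)‖ < 1 := h
    simp at h'
  rcases this with h | ⟨h, -⟩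
  · apply h
    have : redPoly K 1 = 1 := by simp [redPoly]
    rw [this]; exact isCoprime_one_right
  · have : redPoly K (X ^ d) = X ^ d := by simp [redPoly]
    rw [this, natDegree_X_pow, hd] at h
    exact lt_irrefl _ h

lemma exists_two_fixed (f : RatFunc K) (hd : 1 < rdeg K f)
    (hch : ∀ i, 0 < i → i < rdeg K f → ((rdeg K f).choose i : K) = 0)
    {α β γ δ : K} (hP : f.num = C α * X ^ (rdeg K f) + C β)
    (hQ : f.denom = C γ * X ^ (rdeg K f) + C δ) :
    ∃ u v : K, u ≠ v ∧ f.num.eval u = u * f.denom.eval u ∧ f.num.eval v = v * f.denom.eval v := by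
  have hd1 := hch 1 one_pos hd
  rw [Nat.choose_one_right] at hd1
  have htop := top_coeff f hd
  have hcop := f.isCoprime_num_denom
  set R : K[X] := X * f.denom - f.num with hR
  have hder : derivative R = f.denom := by
    rw [hR, derivative_sub, derivative_mul, derivative_X, hQ, hP]
    simp [derivative_X_pow, hd1]
  have hsep : R.Separable := by
    rw [Polynomial.Separable, hder, hR]
    have h1 : IsCoprime (-f.num) f.denom := hcop.neg_left
    have := h1.add_mul_right_left X
    have e : X * f.denom - f.num = -f.num + X * f.denom := by ring
    rw [e]
    exact this
  have hRdeg : 2 ≤ R.natDegree := by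
    by_cases hγ : γ = 0
    · have hα : α ≠ 0 := by
        intro h
        apply htop
        rw [hP, hQ]
        have : rdeg K f ≠ 0 := by omega
        simp [h, hγ, coeff_C, this]
      refine le_trans (show 2 ≤ rdeg K f by omega) (le_natDegree_of_ne_zero ?_)
      obtain ⟨e, he⟩ : ∃ e, rdeg K f = e + 2 := ⟨rdeg K f - 2, by omega⟩
      rw [hR, hP, hQ, hγ, he]
      simp [coeff_X_mul, coeff_C, hα]
    · refine le_trans (show 2 ≤ rdeg K f + 1 by omega) (le_natDegree_of_ne_zero ?_)
      have h0 : rdeg K f ≠ 0 := by omega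
      rw [hR, hP, hQ]
      simp [coeff_X_mul, coeff_C, coeff_X_pow, hγ, h0]
  have hR0 : R ≠ 0 := by intro h; rw [h] at hRdeg; simp at hRdeg
  have hcard : 1 < R.roots.toFinset.card := by
    rw [Multiset.toFinset_card_of_nodup (nodup_roots hsep),
      ← (IsAlgClosed.splits R).natDegree_eq_card_roots]
    omega
  obtain ⟨u, hu, v, hv, huv⟩ := Finset.one_lt_card.1 hcard
  have hroot : ∀ t, t ∈ R.roots.toFinset → f.num.eval t = t * f.denom.eval t := by
    intro t ht
    rw [Multiset.mem_toFinset, mem_roots hR0, IsRoot.def, hR] at ht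
    simp only [eval_sub, eval_mul, eval_X] at ht
    exact (sub_eq_zero.1 ht).symm
  exact ⟨u, v, huv, hroot u hu, hroot v hv⟩

lemma TR_finite (f : RatFunc K) (hd : 1 < rdeg K f) (hf : NoPotentiallyGoodReductions K f) :
    (TRset (evalP1 K f)).Finite := by
  by_contra hTinf
  have hinf : {x : K | (x : OnePoint K) ∈ TRset (evalP1 K f) ∧ f.denom.eval x ≠ 0}.Infinite := by
    intro hfin
    apply hTinf
    refine (((hfin.union (f.denom.roots.toFinset.finite_toSet)).image
      (fun x : K => (x : OnePoint K))).insert OnePoint.infty).subset ?_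
    intro q hq
    induction q using OnePoint.rec with
    | infty => exact Set.mem_insert _ _
    | coe a =>
      refine Set.mem_insert_of_mem _ ⟨a, ?_, rfl⟩
      by_cases h0 : f.denom.eval a = 0
      · right
        simp [f.denom_ne_zero, h0]
      · exact Or.inl ⟨hq, h0⟩
  have hch := choose_zero f hd hinf
  obtain ⟨α, β, γ, δ, hP, hQ⟩ := binomial_form f hd hinf
  obtain ⟨u, v, huv, hu, hv⟩ := exists_two_fixed f hd hch hP hQ
  have hQu : f.denom.eval u ≠ 0 := fun h => no_common_root f u (by rw [hu, h, mul_zero]) h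
  have hQv : f.denom.eval v ≠ 0 := fun h => no_common_root f v (by rw [hv, h, mul_zero]) h
  have hpen := pencil_ne f hd (u, 1) (by simp)
  obtain ⟨e, he⟩ : ∃ e, rdeg K f = e + 2 := ⟨rdeg K f - 2, by omega⟩
  obtain ⟨s, hs⟩ := IsAlgClosed.exists_pow_nat_eq ((f.denom.eval u)⁻¹) (n := e + 1) (by omega)
  obtain ⟨t, ht⟩ := IsAlgClosed.exists_pow_nat_eq ((f.denom.eval v)⁻¹) (n := e + 1) (by omega)
  have hs0 : s ≠ 0 := by
    rintro rfl
    rw [zero_pow (by omega)] at hs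
    exact inv_ne_zero hQu hs.symm
  have ht0 : t ≠ 0 := by
    rintro rfl
    rw [zero_pow (by omega)] at ht
    exact inv_ne_zero hQv ht.symm
  have huv' : u - v ≠ 0 := sub_ne_zero.2 huv
  -- key scalar identities
  have kQu : s ^ (e + 2) * (γ * u ^ (e + 2) + δ) = s := by
    have : f.denom.eval u = γ * u ^ (e + 2) + δ := by rw [hQ, he]; simp
    rw [← this, pow_succ, hs]; field_simp
  have kQv : t ^ (e + 2) * (γ * v ^ (e + 2) + δ) = t := by
    have : f.denom.eval v = γ * v ^ (e + 2) + δ := by rw [hQ, he]; simp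
    rw [← this, pow_succ, ht]; field_simp
  have kPu : s ^ (e + 2) * (α * u ^ (e + 2) + β) = s * u := by
    have h1 : f.num.eval u = α * u ^ (e + 2) + β := by rw [hP, he]; simp
    have h2 : f.denom.eval u = γ * u ^ (e + 2) + δ := by rw [hQ, he]; simp
    rw [h1, h2] at hu
    rw [hu]; linear_combination u * kQu
  have kPv : t ^ (e + 2) * (α * v ^ (e + 2) + β) = t * v := by
    have h1 : f.num.eval v = α * v ^ (e + 2) + β := by rw [hP, he]; simp
    have h2 : f.denom.eval v = γ * v ^ (e + 2) + δ := by rw [hQ, he]; simp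
    rw [h1, h2] at hv
    rw [hv]; linear_combination v * kQv
  set am : K →+* RatFunc K := algebraMap K (RatFunc K) with ham
  have aminj : Function.Injective am := am.injective
  have am0 : ∀ {z : K}, z ≠ 0 → am z ≠ 0 := fun h => (map_ne_zero am).2 h
  have hadd : ∀ a b : RatFunc K, (a + b) ^ (e + 2) = a ^ (e + 2) + b ^ (e + 2) := by
    refine add_pow_of_choose (by omega) fun i h1 h2 => ?_
    have := congrArg am (hch i h1 (by omega))
    rw [he] at this
    simpa using this
  have amC : ∀ z : K, algebraMap K[X] (RatFunc K) (C z) = am z := fun z => rfl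
  -- the Moebius maps
  set Nφ : K[X] := C t * X - C (t * v) with hNφ
  set Dφ : K[X] := C (-s) * X + C (s * u) with hDφ
  set Nψ : K[X] := C (s * u) * X + C (t * v) with hNψ
  set Dψ : K[X] := C s * X + C t with hDψ
  set φ : RatFunc K := algebraMap K[X] (RatFunc K) Nφ / algebraMap K[X] (RatFunc K) Dφ with hφ
  set ψ : RatFunc K := algebraMap K[X] (RatFunc K) Nψ / algebraMap K[X] (RatFunc K) Dψ with hψ
  have dDφ : Dφ.natDegree = 1 := natDegree_linear (neg_ne_zero.2 hs0)
  have dDψ : Dψ.natDegree = 1 := natDegree_linear hs0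
  have dNφ : Nφ.natDegree ≤ 1 := by rw [hNφ]; compute_degree
  have dNψ : Nψ.natDegree ≤ 1 := by rw [hNψ]; compute_degree
  have Dφ0 : Dφ ≠ 0 := by intro h; rw [h] at dDφ; simp at dDφ
  have Dψ0 : Dψ ≠ 0 := by intro h; rw [h] at dDψ; simp at dDψ
  have hst : s * t * (u - v) ≠ 0 := mul_ne_zero (mul_ne_zero hs0 ht0) huv'
  have cφ : IsCoprime Nφ Dφ := by
    refine ⟨C (s * (s * t * (u - v))⁻¹), C (t * (s * t * (u - v))⁻¹), ?_⟩
    have h1 : (C (s * t * (u - v)) * C ((s * t * (u - v))⁻¹) : K[X]) = 1 := by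
      rw [← C_mul, mul_inv_cancel₀ hst, C_1]
    rw [hNφ, hDφ]
    rw [← h1]
    simp only [C_mul, C_sub, C_neg]
    ring
  have cψ : IsCoprime Nψ Dψ := by
    have hx : t * (v - u) ≠ 0 := mul_ne_zero ht0 (sub_ne_zero.2 huv.symm)
    refine ⟨C ((t * (v - u))⁻¹), C (-u * (t * (v - u))⁻¹), ?_⟩
    have h1 : (C (t * (v - u)) * C ((t * (v - u))⁻¹) : K[X]) = 1 := by
      rw [← C_mul, mul_inv_cancel₀ hx, C_1]
    rw [hNψ, hDψ]
    rw [← h1]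
    simp only [C_mul, C_sub, C_neg]
    ring
  have rφ : rdeg K φ = 1 := by
    rw [rdeg_eq φ Dφ0 cφ hφ, dDφ]; omega
  have rψ : rdeg K ψ = 1 := by
    rw [rdeg_eq ψ Dψ0 cψ hψ, dDψ]; omega
  -- values
  set x : RatFunc K := RatFunc.X with hx
  set L : RatFunc K := am s * x + am t with hL
  have eDψ : algebraMap K[X] (RatFunc K) Dψ = L := by
    rw [hDψ, hL, map_add, map_mul, amC, amC, RatFunc.algebraMap_X]
  have eNψ : algebraMap K[X] (RatFunc K) Nψ = am (s * u) * x + am (t * v) := by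
    rw [hNψ, map_add, map_mul, amC, amC, RatFunc.algebraMap_X]
  have hL0 : L ≠ 0 := by rw [← eDψ]; exact RatFunc.algebraMap_ne_zero Dψ0
  have eψ : ψ * L = am (s * u) * x + am (t * v) := by
    rw [hψ, eDψ, eNψ, div_mul_cancel₀ _ hL0]
  have aC : ∀ (g : RatFunc K) (z : K), aeval g (C z) = am z := fun g z => aeval_C g z
  have hamst : am (s * t * (u - v)) ≠ 0 := am0 hst
  -- φ ∘ ψ = X
  have v1 : aeval ψ Dφ * L = am (s * t * (u - v)) := by
    rw [hDφ, map_add, map_mul, aC, aC, aeval_X]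
    simp only [map_mul, map_sub, map_neg] at eψ ⊢
    rw [hL] at eψ ⊢
    linear_combination (-am s) * eψ
  have v2 : aeval ψ Nφ * L = am (s * t * (u - v)) * x := by
    rw [hNφ, map_sub, map_mul, aC, aC, aeval_X]
    simp only [map_mul, map_sub, map_neg] at eψ ⊢
    rw [hL] at eψ ⊢
    linear_combination (am t) * eψ
  have hφψ : rcomp K φ ψ = RatFunc.X := by
    have h0 : aeval ψ Dφ ≠ 0 := by
      intro h; rw [h, zero_mul] at v1; exact hamst v1.symm
    rw [rcomp_eq φ ψ hφ h0, div_eq_iff h0]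
    apply mul_right_cancel₀ hL0
    rw [v2, mul_assoc _ _ L, v1, mul_comm]
  -- φ ∘ f
  set N2 : K[X] := C t * f.num - C (t * v) * f.denom with hN2
  set D2 : K[X] := C (-s) * f.num + C (s * u) * f.denom with hD2
  have D20 : D2 ≠ 0 := by
    have : D2 = C (-s) * (C (1 : K) * f.num - C u * f.denom) := by
      rw [hD2]; simp only [C_mul, C_neg, C_1]; ring
    rw [this]
    exact mul_ne_zero (C_ne_zero.2 (neg_ne_zero.2 hs0)) hpen
  set q : RatFunc K := algebraMap K[X] (RatFunc K) f.denom with hq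
  have hq0 : q ≠ 0 := RatFunc.algebraMap_ne_zero f.denom_ne_zero
  have hfq : f * q = algebraMap K[X] (RatFunc K) f.num := by
    have h1 := RatFunc.num_div_denom f
    rw [← hq, div_eq_iff hq0] at h1
    exact h1.symm
  have w1 : aeval f Dφ * q = algebraMap K[X] (RatFunc K) D2 := by
    rw [hDφ, hD2, map_add, map_mul, aC, aC, aeval_X, map_add]
    simp only [map_mul, amC, ← hfq, ← hq]
    ring
  have w2 : aeval f Nφ * q = algebraMap K[X] (RatFunc K) N2 := by
    rw [hNφ, hN2, map_sub, map_mul, aC, aC, aeval_X, map_sub]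
    simp only [map_mul, amC, ← hfq, ← hq]
    ring
  have hφf : rcomp K φ f = algebraMap K[X] (RatFunc K) N2 / algebraMap K[X] (RatFunc K) D2 := by
    have h0 : aeval f Dφ ≠ 0 := by
      intro h; rw [h, zero_mul] at w1
      exact RatFunc.algebraMap_ne_zero D20 w1.symm
    rw [rcomp_eq φ f hφ h0, ← w1, ← w2, mul_div_mul_right _ _ hq0]
  -- P(ψ), Q(ψ)
  have hLp : L ^ (e + 2) = am s ^ (e + 2) * x ^ (e + 2) + am t ^ (e + 2) := by
    rw [hL, hadd, mul_pow]
  have hψp : ψ ^ (e + 2) * L ^ (e + 2) =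
      am (s * u) ^ (e + 2) * x ^ (e + 2) + am (t * v) ^ (e + 2) := by
    rw [← mul_pow, eψ, hadd, mul_pow]
  have kk : ∀ {a b : K}, a = b → am a = am b := fun h => by rw [h]
  have pP : aeval ψ f.num * L ^ (e + 2) = am (s * u) * x ^ (e + 2) + am (t * v) := by
    have a1 := kk kPu
    have a2 := kk kPv
    rw [hP, he, map_add, map_mul, map_pow, aC, aC, aeval_X]
    simp only [map_mul, map_add, map_pow] at a1 a2 hψp ⊢
    linear_combination (am α) * hψp + (am β) * hLp + x ^ (e + 2) * a1 + a2
  have pQ : aeval ψ f.denom * L ^ (e + 2) = am s * x ^ (e + 2) + am t := by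
    have a1 := kk kQu
    have a2 := kk kQv
    rw [hQ, he, map_add, map_mul, map_pow, aC, aC, aeval_X]
    simp only [map_mul, map_add, map_pow] at a1 a2 hψp ⊢
    linear_combination (am γ) * hψp + (am δ) * hLp + x ^ (e + 2) * a1 + a2
  have z1 : aeval ψ D2 * L ^ (e + 2) = am (s * t * (u - v)) := by
    rw [hD2, map_add, map_mul, map_mul, aC, aC]
    simp only [map_mul, map_sub, map_neg] at pP ⊢
    linear_combination (-am s) * pP + (am s * am u) * pQ
  have z2 : aeval ψ N2 * L ^ (e + 2) = am (s * t * (u - v)) * x ^ (e + 2) := by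
    rw [hN2, map_sub, map_mul, map_mul, aC, aC]
    simp only [map_mul, map_sub, map_neg] at pP ⊢
    linear_combination (am t) * pP - (am t * am v) * pQ
  have hLp0 : L ^ (e + 2) ≠ 0 := pow_ne_zero _ hL0
  have hconj : rcomp K (rcomp K φ f) ψ = RatFunc.X ^ (e + 2) := by
    have h0 : aeval ψ D2 ≠ 0 := by
      intro h; rw [h, zero_mul] at z1; exact hamst z1.symm
    rw [rcomp_eq _ ψ hφf h0, div_eq_iff h0]
    apply mul_right_cancel₀ hLp0
    rw [z2, mul_assoc _ _ (L ^ (e + 2)), z1, mul_comm]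
  exact good_red_contra f φ ψ rφ rψ hφψ (e + 2) he hconj hf

end TotallyRamified

/-- A priori bound for a fixed non-exceptional target `a ∈ P^1(K) \ E(f)`:
if `f` has degree `d > 1` and no potentially good reductions and `D ⊆ P^1(K)` is a non-empty
open set, then `lim_{n→∞} (sup_{w ∈ D} log [fⁿ(w), a]) / dⁿ = 0`.
(Stated in `ε`-form via the exponential, as the trivial upper bound together with the
essential lower bound on the supremum.) -/
theorem apriori_bound_constant_target (f : RatFunc K)
    (hd : 1 < rdeg K f) (hf : NoPotentiallyGoodReductions K f)
    (a : OnePoint K) (ha : a ∉ exceptionalSet K f)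
    (D : Set (OnePoint K)) (hD : IsOpen D) (hDne : D.Nonempty) :
    ∀ ε : ℝ, 0 < ε → ∀ᶠ n : ℕ in atTop,
      (∀ w ∈ D, chordal K ((evalP1 K f)^[n] w) a ≤ Real.exp (ε * (rdeg K f : ℝ) ^ n)) ∧
      ∃ w ∈ D, Real.exp (-ε * (rdeg K f : ℝ) ^ n) ≤ chordal K ((evalP1 K f)^[n] w) a := by
  exact final_of_TR f hd (TR_finite f hd hf) a ha D hD hDne
end

section
/- Let U and V be domains (non-empty connected open subsets) in the Berkovich projective line P^1_Berk(K) such that U ∩ V = ∅ and ∂U ∩ ∂V ≠ ∅. Then ∂U ∩ ∂V is a singleton {S_0} with S_0 ∈ P^1_Berk(K) \ P^1(K), and moreover U and V are contained in two distinct connected components of P^1_Berk(K) \ {S_0}. -/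
open scoped Classical
open Polynomial Filter MeasureTheory Topology

variable (K : Type*) [NontriviallyNormedField K] [IsAlgClosed K] [CompleteSpace K]
  [IsUltrametricDist K]

/-- The Berkovich affine line `A^1(K)`: multiplicative seminorms on `K[z]`
whose restriction to `K` is the absolute value of `K`. -/
structure BerkA1 where
  /-- the seminorm, as a function on polynomials -/
  toFun : Polynomial K → ℝ
  nonneg' : ∀ p, 0 ≤ toFun p
  map_mul' : ∀ p q, toFun (p * q) = toFun p * toFun q
  add_le' : ∀ p q, toFun (p + q) ≤ toFun p + toFun q
  restricts' : ∀ c : K, toFun (Polynomial.C c) = ‖c‖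

/-- The topology of pointwise convergence on the Berkovich affine line. -/
instance : TopologicalSpace (BerkA1 K) :=
  TopologicalSpace.induced BerkA1.toFun Pi.topologicalSpace

/-- The Berkovich projective line `P^1_Berk(K)`, the one-point compactification of the
Berkovich affine line. -/
abbrev BerkP1 := OnePoint (BerkA1 K)

/-- The evaluation seminorm `p ↦ ‖p(a)‖` attached to a classical point `a ∈ K`. -/
noncomputable def evalSeminorm (a : K) : BerkA1 K where
  toFun p := ‖p.eval a‖
  nonneg' p := norm_nonneg _
  map_mul' p q := by simp [norm_mul]
  add_le' p q := by simpa using norm_add_le (p.eval a) (q.eval a)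
  restricts' c := by simp

/-- The canonical embedding of the classical projective line `P^1(K) = K ∪ {∞}`
into the Berkovich projective line. -/
noncomputable def iota : OnePoint K → BerkP1 K :=
  OnePoint.map (evalSeminorm K)

noncomputable instance : MeasurableSpace (BerkP1 K) := borel _

instance : BorelSpace (BerkP1 K) := ⟨rfl⟩

/-- The support of a measure: points all of whose open neighborhoods have positive measure. -/
def msupport (μ : Measure (BerkP1 K)) : Set (BerkP1 K) :=
  {x | ∀ U : Set (BerkP1 K), IsOpen U → x ∈ U → 0 < μ U}

/-- Weak convergence of a sequence of measures on the Berkovich projective line: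
integrals of every continuous real-valued function converge. -/
def WeakTendsto (μs : ℕ → Measure (BerkP1 K)) (μ : Measure (BerkP1 K)) : Prop :=
  ∀ φ : C(BerkP1 K, ℝ),
    Tendsto (fun n => ∫ x, φ x ∂(μs n)) atTop (𝓝 (∫ x, φ x ∂μ))

namespace BerkAux

section

variable {K}

theorem toFun_zero (x : BerkA1 K) : x.toFun 0 = 0 := by
  have := x.restricts' 0
  simpa using this

theorem toFun_one (x : BerkA1 K) : x.toFun 1 = 1 := by
  have := x.restricts' 1
  simpa using this

theorem toFun_pow (x : BerkA1 K) (p : K[X]) (n : ℕ) : x.toFun (p ^ n) = x.toFun p ^ n := by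
  induction n with
  | zero => simp [toFun_one]
  | succ n ih => rw [pow_succ, x.map_mul', ih, pow_succ]

theorem toFun_sum_le (x : BerkA1 K) (s : Finset ℕ) (f : ℕ → K[X]) :
    x.toFun (∑ i ∈ s, f i) ≤ ∑ i ∈ s, x.toFun (f i) := by
  induction s using Finset.induction_on with
  | empty => simp [toFun_zero]
  | insert a s ha ih =>
    rw [Finset.sum_insert ha, Finset.sum_insert ha]
    exact (x.add_le' _ _).trans (by gcongr)

theorem toFun_natCast_le (x : BerkA1 K) (n : ℕ) : x.toFun (n : K[X]) ≤ 1 := by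
  have := x.restricts' (n : K)
  rw [Polynomial.C_eq_natCast] at this
  rw [this]
  exact IsUltrametricDist.norm_natCast_le_one K n

theorem toFun_add_le_max (x : BerkA1 K) (p q : K[X]) :
    x.toFun (p + q) ≤ max (x.toFun p) (x.toFun q) := by
  refine le_of_forall_gt_imp_ge_of_dense fun a ha ↦ ?_
  obtain ⟨b, hb, hba⟩ := exists_between ha
  obtain ⟨hpb, hqb⟩ := max_lt_iff.mp hb
  have hb0 : 0 < b := (x.nonneg' p).trans_lt hpb
  obtain ⟨m, hm⟩ : ∃ m : ℕ, ((m + 1) : ℕ) < (a / b) ^ m := by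
    apply_mod_cast Real.exists_natCast_add_one_lt_pow_of_one_lt
    rwa [one_lt_div hb0]
  rw [div_pow, lt_div_iff₀ (by positivity)] at hm
  have key : x.toFun (p + q) ^ m ≤ ((m + 1 : ℕ) : ℝ) * b ^ m := by
    rw [← toFun_pow, add_pow]
    refine (toFun_sum_le x _ _).trans ?_
    have : ∀ i ∈ Finset.range (m + 1),
        x.toFun (p ^ i * q ^ (m - i) * (m.choose i : K[X])) ≤ b ^ m := by
      intro i hi
      rw [x.map_mul', x.map_mul', toFun_pow, toFun_pow]
      have h1 := toFun_natCast_le x (m.choose i)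
      have h0 := x.nonneg' (m.choose i : K[X])
      have hp := x.nonneg' p
      have hq := x.nonneg' q
      calc _ ≤ b ^ i * b ^ (m - i) * 1 := by gcongr
        _ = b ^ m := by
          rw [mul_one, ← pow_add]
          congr 1
          have := Finset.mem_range.mp hi
          omega
    calc _ ≤ ∑ i ∈ Finset.range (m + 1), b ^ m := Finset.sum_le_sum this
      _ = _ := by simp
  refine le_of_pow_le_pow_left₀ (n := m) (fun h ↦ ?_) (hb0.trans hba).le (key.trans hm.le)
  subst h
  simp at hm

/-- The value of the seminorm at `z - a`. -/
noncomputable def dl (a : K) (x : BerkA1 K) : ℝ := x.toFun (X - C a)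

theorem dl_nonneg (a : K) (x : BerkA1 K) : 0 ≤ dl a x := x.nonneg' _

theorem toFun_C_mul (x : BerkA1 K) (c : K) (p : K[X]) :
    x.toFun (C c * p) = ‖c‖ * x.toFun p := by rw [x.map_mul', x.restricts']

theorem toFun_neg (x : BerkA1 K) (p : K[X]) : x.toFun (-p) = x.toFun p := by
  have := toFun_C_mul x (-1) p
  simpa using this

theorem dl_le (a b : K) (x : BerkA1 K) : dl b x ≤ max (dl a x) ‖a - b‖ := by
  have h := toFun_add_le_max x (X - C a) (C (a - b))
  rw [x.restricts'] at h
  have e : (X - C a) + C (a - b) = (X - C b : K[X]) := by rw [C_sub]; ring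
  rw [e] at h
  exact h

theorem norm_le (a b : K) (x : BerkA1 K) : ‖a - b‖ ≤ max (dl a x) (dl b x) := by
  have h := toFun_add_le_max x (-(X - C a)) (X - C b)
  rw [toFun_neg] at h
  have e : (-(X - C a)) + (X - C b) = (C (a - b) : K[X]) := by rw [C_sub]; ring
  rw [e, x.restricts'] at h
  exact h

theorem berk_ext {x y : BerkA1 K} (h : ∀ a, dl a x = dl a y) : x = y := by
  have key : ∀ p, x.toFun p = y.toFun p := by
    intro p
    have hs := (IsAlgClosed.splits p).eq_prod_roots
    rw [hs, toFun_C_mul, toFun_C_mul]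
    congr 1
    generalize p.roots = s
    induction s using Multiset.induction_on with
    | empty => simp [toFun_one]
    | cons a s ih =>
      rw [Multiset.map_cons, Multiset.prod_cons, x.map_mul', y.map_mul', ih]
      congr 1
      exact h a
  cases x; cases y
  congr
  funext p
  exact key p

theorem continuous_toFun : Continuous (BerkA1.toFun : BerkA1 K → K[X] → ℝ) :=
  continuous_induced_dom

theorem continuous_dl (a : K) : Continuous (dl a : BerkA1 K → ℝ) :=
  (continuous_apply (X - C a)).comp continuous_toFun

theorem bound_exists (a : K) (r : ℝ) (p : K[X]) :
    ∃ M, ∀ x : BerkA1 K, dl a x ≤ r → x.toFun p ≤ M := by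
  have hs := (IsAlgClosed.splits p).eq_prod_roots
  have : ∀ s : Multiset K, ∃ M, ∀ x : BerkA1 K, dl a x ≤ r →
      x.toFun (s.map (fun b => X - C b)).prod ≤ M := by
    intro s
    induction s using Multiset.induction_on with
    | empty => exact ⟨1, fun x _ => by simp [toFun_one]⟩
    | cons b s ih =>
      obtain ⟨M, hM⟩ := ih
      refine ⟨max r ‖a - b‖ * M, fun x hx => ?_⟩
      rw [Multiset.map_cons, Multiset.prod_cons, x.map_mul']
      refine mul_le_mul ((dl_le a b x).trans (max_le_max hx le_rfl)) (hM x hx) (x.nonneg' _) ?_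
      exact (norm_nonneg _).trans (le_max_right _ _)
  obtain ⟨M, hM⟩ := this p.roots
  refine ⟨‖p.leadingCoeff‖ * M, fun x hx => ?_⟩
  calc x.toFun p = x.toFun (C p.leadingCoeff * (p.roots.map (fun b => X - C b)).prod) := by
        rw [← hs]
    _ ≤ _ := by
        rw [toFun_C_mul]
        exact mul_le_mul_of_nonneg_left (hM x hx) (norm_nonneg _)

theorem range_closed : IsClosed (Set.range (BerkA1.toFun : BerkA1 K → K[X] → ℝ)) := by
  have e : Set.range (BerkA1.toFun : BerkA1 K → K[X] → ℝ) =
      (⋂ p, {f | 0 ≤ f p}) ∩ (⋂ p, ⋂ q, {f | f (p * q) = f p * f q}) ∩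
      (⋂ p, ⋂ q, {f | f (p + q) ≤ f p + f q}) ∩ (⋂ c : K, {f | f (C c) = ‖c‖}) := by
    ext f
    simp only [Set.mem_range, Set.mem_inter_iff, Set.mem_iInter, Set.mem_ofPred_eq]
    constructor
    · rintro ⟨x, rfl⟩
      exact ⟨⟨⟨x.nonneg', x.map_mul'⟩, x.add_le'⟩, x.restricts'⟩
    · rintro ⟨⟨⟨h1, h2⟩, h3⟩, h4⟩
      exact ⟨⟨f, h1, h2, h3, h4⟩, rfl⟩
  rw [e]
  refine IsClosed.inter (IsClosed.inter (IsClosed.inter ?_ ?_) ?_) ?_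
  · exact isClosed_iInter fun p => isClosed_le continuous_const (continuous_apply p)
  · exact isClosed_iInter fun p => isClosed_iInter fun q =>
      isClosed_eq (continuous_apply _) ((continuous_apply p).mul (continuous_apply q))
  · exact isClosed_iInter fun p => isClosed_iInter fun q =>
      isClosed_le (continuous_apply _) ((continuous_apply p).add (continuous_apply q))
  · exact isClosed_iInter fun c => isClosed_eq (continuous_apply _) continuous_const

theorem isCompact_ball (a : K) (r : ℝ) : IsCompact {x : BerkA1 K | dl a x ≤ r} := by
  choose M hM using bound_exists (K := K) a r
  have hc : IsCompact (Set.pi Set.univ fun p : K[X] => Set.Icc 0 (M p)) :=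
    isCompact_univ_pi fun p => isCompact_Icc
  have hemb : IsClosedEmbedding (BerkA1.toFun : BerkA1 K → K[X] → ℝ) := by
    refine ⟨⟨⟨rfl⟩, ?_⟩, range_closed⟩
    intro x y h
    cases x; cases y
    congr
  have h2 := hemb.isCompact_preimage hc
  refine h2.of_isClosed_subset (isClosed_le (continuous_dl a) continuous_const) ?_
  intro x hx
  simp only [Set.mem_preimage, Set.mem_pi, Set.mem_univ, true_implies, Set.mem_Icc]
  exact fun p => ⟨x.nonneg' p, hM p x hx⟩

/-- `S` is the point attached to the disc of centre `a` and radius `r`. -/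
def IsBall (a : K) (r : ℝ) (S : BerkA1 K) : Prop := ∀ b, dl b S = max r ‖a - b‖

theorem nonarch_norm : IsNonarchimedean (IsAbsoluteValue.toAbsoluteValue (norm : K → ℝ)) := by
  intro a b
  exact IsUltrametricDist.norm_add_le_max a b

theorem exists_ball (a : K) {r : ℝ} (hr : 0 < r) : ∃ S : BerkA1 K, IsBall a r S := by
  set v := IsAbsoluteValue.toAbsoluteValue (norm : K → ℝ) with hv
  refine ⟨⟨fun p => (p.comp (X + C a)).gaussNorm v r, ?_, ?_, ?_, ?_⟩, ?_⟩
  · exact fun p => gaussNorm_nonneg _ _ hr.le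
  · intro p q
    rw [mul_comp, gaussNorm_mul nonarch_norm hr]
  · intro p q
    rw [add_comp]
    refine (isNonarchimedean_gaussNorm v nonarch_norm hr.le _ _).trans ?_
    exact max_le_add_of_nonneg (gaussNorm_nonneg _ _ hr.le) (gaussNorm_nonneg _ _ hr.le)
  · intro c
    rw [C_comp, gaussNorm_C]
    rfl
  · intro b
    change ((X - C b).comp (X + C a)).gaussNorm v r = _
    have e : (X - C b).comp (X + C a) = X + C (a - b) := by
      rw [sub_comp, X_comp, C_comp, C_sub]; ring
    rw [e]
    apply le_antisymm
    · refine (isNonarchimedean_gaussNorm v nonarch_norm hr.le _ _).trans ?_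
      rw [gaussNorm_C]
      have : (X : K[X]).gaussNorm v r = r := by
        rw [← monomial_one_one_eq_X, gaussNorm_monomial]
        simp
      rw [this]
      exact le_rfl
    · apply max_le
      · have := le_gaussNorm v (X + C (a - b)) hr.le 1
        simpa [coeff_X, coeff_C] using this
      · have := le_gaussNorm v (X + C (a - b)) hr.le 0
        have e0 : (X + C (a - b) : K[X]).coeff 0 = a - b := by simp
        rw [e0, pow_zero, mul_one] at this
        exact this

/-- Partial order by pointwise comparison on linear polynomials. -/
def Below (x S : BerkA1 K) : Prop := ∀ a, dl a x ≤ dl a S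

theorem norm_of_lt {a b : K} {x : BerkA1 K} (h : dl a x < ‖a - b‖) : dl b x = ‖a - b‖ := by
  have h1 := dl_le a b x
  have h2 := norm_le a b x
  rw [max_eq_right h.le] at h1
  rcases le_max_iff.mp h2 with h3 | h3
  · linarith
  · exact le_antisymm h1 h3

theorem dl_of_gt {a b : K} {x : BerkA1 K} (h : ‖a - b‖ < dl a x) : dl b x = dl a x := by
  have h1 := dl_le a b x
  have h2 := dl_le b a x
  rw [max_eq_left h.le] at h1
  rw [norm_sub_rev] at h2
  rcases le_max_iff.mp h2 with h3 | h3
  · exact le_antisymm h1 h3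
  · linarith

theorem isBall_of_below {a : K} {x S : BerkA1 K} (h : Below x S) (hlt : dl a x < dl a S) :
    IsBall a (dl a S) S := by
  intro b
  rcases lt_trichotomy ‖a - b‖ (dl a S) with h1 | h1 | h1
  · rw [max_eq_left h1.le, dl_of_gt h1]
  · rw [h1, max_self]
    apply le_antisymm
    · have := dl_le a b S
      rwa [h1, max_self] at this
    · rw [← h1] at hlt ⊢
      rw [← norm_of_lt hlt]
      exact h b
  · rw [max_eq_right h1.le, norm_of_lt h1]

theorem below_ball {a : K} {r : ℝ} {x S : BerkA1 K} (hS : IsBall a r S) (h : dl a x ≤ r) :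
    Below x S := by
  intro b
  rw [hS b]
  exact (dl_le a b x).trans (max_le_max h le_rfl)

theorem dl_center {a : K} {r : ℝ} (hr : 0 ≤ r) {S : BerkA1 K} (hS : IsBall a r S) :
    dl a S = r := by
  rw [hS a]; simp [hr]

theorem exists_lt_of_below {x S : BerkA1 K} (h : Below x S) (hne : x ≠ S) :
    ∃ a, dl a x < dl a S := by
  by_contra! hc
  exact hne (berk_ext fun a => le_antisymm (h a) (hc a))

/-- `A` and `B` form a separation of the complement of `t`. -/
def Sep (t : BerkP1 K) (A B : Set (BerkP1 K)) : Prop :=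
  IsOpen A ∧ IsOpen B ∧ Disjoint A B ∧ A ∪ B = {t}ᶜ

theorem Sep.symm {t : BerkP1 K} {A B : Set (BerkP1 K)} (h : Sep t A B) : Sep t B A :=
  ⟨h.2.1, h.1, h.2.2.1.symm, by rw [Set.union_comm]; exact h.2.2.2⟩

/-- A separation from a set of affine points. -/
theorem sep_of (S : BerkA1 K) (D : Set (BerkA1 K)) (hD : IsOpen D) (hS : S ∉ D)
    (hDS : IsClosed (D ∪ {S})) (a : K) (r : ℝ) (hb : ∀ x ∈ D ∪ {S}, dl a x ≤ r) :
    Sep (S : BerkP1 K) (((↑) : BerkA1 K → BerkP1 K) '' D)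
      (((↑) : BerkA1 K → BerkP1 K) '' (D ∪ {S}))ᶜ := by
  refine ⟨OnePoint.isOpen_image_coe.2 hD, OnePoint.isOpen_compl_image_coe.2
    ⟨hDS, (isCompact_ball a r).of_isClosed_subset hDS hb⟩, ?_, ?_⟩
  · rw [Set.disjoint_compl_right_iff_subset]
    exact Set.image_mono Set.subset_union_left
  · ext x
    induction x using OnePoint.rec with
    | infty => simp
    | coe x =>
      simp only [Set.mem_union, Set.mem_image, Set.mem_compl_iff, OnePoint.coe_eq_coe,
        exists_eq_right, Set.mem_singleton_iff]
      constructor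
      · rintro (h | h)
        · rintro rfl
          exact hS h
        · tauto
      · tauto

theorem sep_below (S : BerkA1 K) :
    Sep (S : BerkP1 K) (((↑) : BerkA1 K → BerkP1 K) '' {x | Below x S ∧ x ≠ S})
      (((↑) : BerkA1 K → BerkP1 K) '' {x | Below x S})ᶜ := by
  have e : {x | Below x S} = {x | Below x S ∧ x ≠ S} ∪ {S} := by
    ext x
    simp only [Set.mem_ofPred_eq, Set.mem_union, Set.mem_singleton_iff]
    constructor
    · tauto
    · rintro (h | rfl)
      · exact h.1
      · exact fun _ => le_rfl
  have hcl : IsClosed {x | Below x S} := by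
    have : {x | Below x S} = ⋂ a, {x | dl a x ≤ dl a S} := by
      ext x; simp [Below]
    rw [this]
    exact isClosed_iInter fun a => isClosed_le (continuous_dl a) continuous_const
  rw [e] at hcl ⊢
  refine sep_of S _ ?_ (by simp) hcl 0 (dl 0 S) ?_
  · rw [isOpen_iff_forall_mem_open]
    rintro x ⟨hx, hne⟩
    obtain ⟨a, ha⟩ := exists_lt_of_below hx hne
    refine ⟨{y | dl a y < dl a S}, ?_, isOpen_lt (continuous_dl a) continuous_const, ha⟩
    intro y hy
    refine ⟨below_ball (isBall_of_below hx ha) (le_of_lt hy), ?_⟩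
    rintro rfl
    exact absurd hy (lt_irrefl (dl a y))
  · rw [← e]
    exact fun x hx => hx 0

theorem sep_ball (S : BerkA1 K) {a : K} {r : ℝ} (hr : 0 ≤ r) (hS : IsBall a r S) :
    Sep (S : BerkP1 K) (((↑) : BerkA1 K → BerkP1 K) '' {x | dl a x < r})
      (((↑) : BerkA1 K → BerkP1 K) '' ({x | dl a x < r} ∪ {S}))ᶜ := by
  have hc := dl_center hr hS
  refine sep_of S _ (isOpen_lt (continuous_dl a) continuous_const) (by simp [hc]) ?_ a r ?_
  · rw [← isOpen_compl_iff, isOpen_iff_forall_mem_open]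
    intro y hy
    simp only [Set.mem_compl_iff, Set.mem_union, Set.mem_ofPred_eq, Set.mem_singleton_iff,
      not_or, not_lt] at hy
    obtain ⟨h1, h2⟩ := hy
    rcases h1.lt_or_eq with h1 | h1
    · refine ⟨{x | r < dl a x}, ?_, isOpen_lt continuous_const (continuous_dl a), h1⟩
      intro x hx
      simp only [Set.mem_compl_iff, Set.mem_union, Set.mem_ofPred_eq, Set.mem_singleton_iff,
        not_or, not_lt] at hx ⊢
      refine ⟨hx.le, ?_⟩
      rintro rfl
      linarith
    · obtain ⟨b, hb⟩ := exists_lt_of_below (below_ball hS h1.symm.le) h2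
      have hab : ‖a - b‖ = r := by
        rcases lt_trichotomy ‖a - b‖ r with h | h | h
        · rw [hS b, max_eq_left h.le, dl_of_gt (by rwa [← h1])] at hb
          linarith
        · exact h
        · rw [hS b, max_eq_right h.le, norm_of_lt (by rwa [← h1])] at hb
          linarith
      have hbS : dl b S = r := by rw [hS b, hab, max_self]
      refine ⟨{x | dl b x < r}, ?_, isOpen_lt (continuous_dl b) continuous_const, by
        simpa [hbS] using hb⟩
      intro x hx
      simp only [Set.mem_compl_iff, Set.mem_union, Set.mem_ofPred_eq, Set.mem_singleton_iff,
        not_or, not_lt] at hx ⊢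
      constructor
      · have h3 : dl b x < ‖b - a‖ := by rwa [norm_sub_rev, hab]
        rw [norm_of_lt h3, norm_sub_rev, hab]
      · rintro rfl
        linarith
  · rintro x (hx | rfl)
    · exact le_of_lt hx
    · exact hc.le

theorem not_classical {x S : BerkA1 K} (h : Below x S) (hne : x ≠ S) (a : OnePoint K) :
    iota K a ≠ (S : BerkP1 K) := by
  induction a using OnePoint.rec with
  | infty =>
    intro h
    exact OnePoint.infty_ne_coe S h
  | coe a =>
    intro h'
    have h2 : evalSeminorm K a = S := OnePoint.coe_injective h'
    subst h2
    apply hne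
    have h3 : dl a x ≤ 0 := by
      have := h a
      simpa [dl, evalSeminorm] using this
    apply berk_ext
    intro b
    apply le_antisymm (h b)
    have h4 : dl b (evalSeminorm K a) = ‖a - b‖ := by simp [dl, evalSeminorm]
    rw [h4]
    rcases le_max_iff.mp (norm_le a b x) with h5 | h5
    · exact (h5.trans h3).trans (dl_nonneg b x)
    · exact h5

theorem separation (S u v : BerkP1 K) (hu : u ≠ S) (hv : v ≠ S) :
    ((∀ a, iota K a ≠ S) ∧ ∃ A B, Sep S A B ∧ u ∈ A ∧ v ∈ B) ∨
    ∃ t A B, Sep t A B ∧ S ∈ A ∧ u ∉ A ∧ v ∉ A := by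
  induction S using OnePoint.rec with
  | infty =>
    right
    obtain ⟨u, rfl⟩ := OnePoint.ne_infty_iff_exists.mp hu
    obtain ⟨v, rfl⟩ := OnePoint.ne_infty_iff_exists.mp hv
    obtain ⟨t, ht⟩ := exists_ball (0 : K) (r := max (max (dl 0 u) (dl 0 v)) 1) (by positivity)
    refine ⟨t, _, _, (sep_below t).symm, by simp, ?_, ?_⟩
    · simpa using below_ball ht (by simp)
    · simpa using below_ball ht (by simp)
  | coe S =>
    by_cases hu' : u ∈ (((↑) : BerkA1 K → BerkP1 K) '' {x | Below x S})
    · obtain ⟨u, hu', rfl⟩ := hu'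
      have huS : u ≠ S := fun h => hu (by rw [h])
      by_cases hv' : v ∈ (((↑) : BerkA1 K → BerkP1 K) '' {x | Below x S})
      · obtain ⟨v, hv', rfl⟩ := hv'
        have hvS : v ≠ S := fun h => hv (by rw [h])
        obtain ⟨a, ha⟩ := exists_lt_of_below hu' huS
        have hB := isBall_of_below hu' ha
        by_cases hva : dl a v < dl a S
        · right
          obtain ⟨s, hs, hs'⟩ := exists_between (max_lt ha hva)
          obtain ⟨h1, h2⟩ := max_lt_iff.mp hs
          have hs0 : 0 < s := (dl_nonneg a u).trans_lt h1
          obtain ⟨t, ht⟩ := exists_ball a hs0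
          refine ⟨t, _, _, (sep_below t).symm, ?_, ?_, ?_⟩
          · simp only [Set.mem_compl_iff, Set.mem_image, OnePoint.coe_eq_coe, exists_eq_right,
              Set.mem_ofPred_eq]
            intro h
            have := h a
            rw [dl_center hs0.le ht] at this
            linarith
          · simpa using below_ball ht h1.le
          · simpa using below_ball ht h2.le
        · left
          refine ⟨not_classical hu' huS, _, _, sep_ball S (dl_nonneg a S) hB, ?_, ?_⟩
          · simpa using ha
          · simp only [Set.mem_compl_iff, Set.mem_image, OnePoint.coe_eq_coe, exists_eq_right,
              Set.mem_union, Set.mem_ofPred_eq, Set.mem_singleton_iff]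
            tauto
      · left
        exact ⟨not_classical hu' huS, _, _, sep_below S, ⟨u, ⟨hu', huS⟩, rfl⟩, hv'⟩
    · by_cases hv' : v ∈ (((↑) : BerkA1 K → BerkP1 K) '' {x | Below x S})
      · left
        obtain ⟨v, hv', rfl⟩ := hv'
        have hvS : v ≠ S := fun h => hv (by rw [h])
        exact ⟨not_classical hv' hvS, _, _, (sep_below S).symm, hu', ⟨v, ⟨hv', hvS⟩, rfl⟩⟩
      · right
        have ex : ∀ w : BerkP1 K, w ∉ (((↑) : BerkA1 K → BerkP1 K) '' {x | Below x S}) →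
            ∃ a, ∀ y : BerkA1 K, (y : BerkP1 K) = w → dl a S < dl a y := by
          intro w hw
          induction w using OnePoint.rec with
          | infty => exact ⟨0, fun y hy => absurd hy (OnePoint.coe_ne_infty y)⟩
          | coe w =>
            simp only [Set.mem_image, OnePoint.coe_eq_coe, exists_eq_right,
              Set.mem_ofPred_eq, Below, not_forall, not_le] at hw
            obtain ⟨a, ha⟩ := hw
            refine ⟨a, fun y hy => ?_⟩
            rw [OnePoint.coe_injective hy]
            exact ha
        have step : ∀ (a b : K) (y : BerkA1 K), dl a S ≤ dl b S → dl b S < dl b y →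
            dl a S < dl a y := by
          intro a b y h1 h2
          by_contra! h3
          have h4 := norm_le a b S
          rw [max_eq_right h1] at h4
          have h5 := (dl_le a b y).trans (max_le (h3.trans h1) h4)
          linarith
        have both : ∃ c, (∀ y : BerkA1 K, (y : BerkP1 K) = u → dl c S < dl c y) ∧
            (∀ y : BerkA1 K, (y : BerkP1 K) = v → dl c S < dl c y) := by
          obtain ⟨a, ha⟩ := ex u hu'
          obtain ⟨b, hb⟩ := ex v hv'
          rcases le_total (dl a S) (dl b S) with h | h
          · exact ⟨a, ha, fun y hy => step a b y h (hb y hy)⟩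
          · exact ⟨b, fun y hy => step b a y h (ha y hy), hb⟩
        obtain ⟨c, hcu, hcv⟩ := both
        have rad : ∀ w : BerkP1 K, (∀ y : BerkA1 K, (y : BerkP1 K) = w → dl c S < dl c y) →
            ∃ s, dl c S < s ∧ ∀ y : BerkA1 K, (y : BerkP1 K) = w → s ≤ dl c y := by
          intro w hw
          induction w using OnePoint.rec with
          | infty => exact ⟨dl c S + 1, by linarith,
              fun y hy => absurd hy (OnePoint.coe_ne_infty y)⟩
          | coe w =>
            refine ⟨dl c w, hw w rfl, fun y hy => ?_⟩
            rw [OnePoint.coe_injective hy]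
        obtain ⟨s, hs, hsu⟩ := rad u hcu
        obtain ⟨s', hs', hsv⟩ := rad v hcv
        have hm : dl c S < min s s' := lt_min hs hs'
        have hm0 := (dl_nonneg c S).trans_lt hm
        obtain ⟨t, ht⟩ := exists_ball c hm0
        refine ⟨t, _, _, sep_ball t hm0.le ht, ⟨S, hm, rfl⟩, ?_, ?_⟩
        · rintro ⟨y, hy, hyu⟩
          have h1 : dl c y < min s s' := hy
          exact absurd (hsu y hyu) (not_le.mpr (h1.trans_le (min_le_left _ _)))
        · rintro ⟨y, hy, hyv⟩
          have h1 : dl c y < min s s' := hy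
          exact absurd (hsv y hyv) (not_le.mpr (h1.trans_le (min_le_right _ _)))

/-- A preconnected set meeting both sides of a separation contains the separating point. -/
theorem mem_of_sep {t : BerkP1 K} {A B W : Set (BerkP1 K)} (h : Sep t A B)
    (hW : IsPreconnected W) {w : BerkP1 K} (hw : w ∈ W) (hwA : w ∉ A)
    (hA : (W ∩ A).Nonempty) : t ∈ W := by
  by_contra ht
  obtain ⟨h1, h2, h3, h4⟩ := h
  have hsub : W ⊆ A ∪ B := by
    rw [h4]
    intro x hx hxt
    exact ht (hxt ▸ hx)
  have hwB : w ∈ B := (hsub hw).resolve_left hwA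
  obtain ⟨z, -, hz⟩ := hW A B h1 h2 hsub hA ⟨w, hw, hwB⟩
  exact Set.disjoint_iff.mp h3 hz

theorem subset_of_sep {t : BerkP1 K} {A B W : Set (BerkP1 K)} (h : Sep t A B)
    (hW : IsPreconnected W) {w : BerkP1 K} (hw : w ∈ W) (hwA : w ∈ A)
    (ht : t ∉ W) : W ⊆ A := by
  intro z hz
  by_contra hzA
  exact ht (mem_of_sep h hW hz hzA ⟨w, hw, hwA⟩)

theorem closure_subset_of_sep {t : BerkP1 K} {A B : Set (BerkP1 K)} (h : Sep t A B) :
    closure A ⊆ A ∪ {t} := by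
  obtain ⟨h1, h2, h3, h4⟩ := h
  have h5 : closure A ⊆ Bᶜ := closure_minimal h3.subset_compl_right h2.isClosed_compl
  intro x hx
  by_contra hc
  simp only [Set.mem_union, Set.mem_singleton_iff, not_or] at hc
  have : x ∈ A ∪ B := by rw [h4]; exact hc.2
  exact this.elim hc.1 (h5 hx)

end

end BerkAux

/-- If `U` and `V` are disjoint domains (non-empty connected open sets) in the Berkovich
projective line with intersecting boundaries, then `∂U ∩ ∂V` is a singleton `{S₀}` with `S₀`
a non-classical point, and `U`, `V` lie in two distinct connected components of the
complement of `{S₀}`. -/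
theorem boundary_intersection_singleton (U V : Set (BerkP1 K))
    (hUo : IsOpen U) (hUc : IsConnected U) (hVo : IsOpen V) (hVc : IsConnected V)
    (hdisj : U ∩ V = ∅) (hbd : (frontier U ∩ frontier V).Nonempty) :
    ∃ S₀ : BerkP1 K, frontier U ∩ frontier V = {S₀} ∧ (∀ a : OnePoint K, iota K a ≠ S₀) ∧
      ∃ x ∈ U, ∃ y ∈ V,
        U ⊆ connectedComponentIn ({S₀}ᶜ : Set (BerkP1 K)) x ∧
        V ⊆ connectedComponentIn ({S₀}ᶜ : Set (BerkP1 K)) y ∧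
        connectedComponentIn ({S₀}ᶜ : Set (BerkP1 K)) x ≠
          connectedComponentIn ({S₀}ᶜ : Set (BerkP1 K)) y := by
  obtain ⟨S, hSU, hSV⟩ := hbd
  have hSU' : S ∉ U := by
    rw [hUo.frontier_eq] at hSU
    exact hSU.2
  have hSV' : S ∉ V := by
    rw [hVo.frontier_eq] at hSV
    exact hSV.2
  obtain ⟨u, hu⟩ := hUc.nonempty
  obtain ⟨v, hv⟩ := hVc.nonempty
  have huS : u ≠ S := fun h => hSU' (h ▸ hu)
  have hvS : v ≠ S := fun h => hSV' (h ▸ hv)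
  rcases BerkAux.separation S u v huS hvS with ⟨hcl, A, B, hsep, huA, hvB⟩ |
    ⟨t, A, B, hsep, hSA, huA, hvA⟩
  · have hUA := BerkAux.subset_of_sep hsep hUc.isPreconnected hu huA hSU'
    have hVB := BerkAux.subset_of_sep hsep.symm hVc.isPreconnected hv hvB hSV'
    have hAB : Disjoint A B := hsep.2.2.1
    refine ⟨S, ?_, hcl, u, hu, v, hv, ?_, ?_, ?_⟩
    · apply Set.Subset.antisymm
      · rintro x ⟨hxU, hxV⟩
        have h1 := BerkAux.closure_subset_of_sep hsep
          (closure_mono hUA (frontier_subset_closure hxU))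
        have h2 := BerkAux.closure_subset_of_sep hsep.symm
          (closure_mono hVB (frontier_subset_closure hxV))
        rcases h1 with h1 | h1
        · rcases h2 with h2 | h2
          · exact (Set.disjoint_left.mp hAB h1 h2).elim
          · exact h2
        · exact h1
      · rintro x rfl
        exact ⟨hSU, hSV⟩
    · exact hUc.isPreconnected.subset_connectedComponentIn hu
        (Set.subset_compl_singleton_iff.mpr hSU')
    · exact hVc.isPreconnected.subset_connectedComponentIn hv
        (Set.subset_compl_singleton_iff.mpr hSV')
    · intro h
      have h1 : v ∈ connectedComponentIn ({S}ᶜ : Set (BerkP1 K)) u := by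
        rw [h]
        exact mem_connectedComponentIn hvS
      have h2 : connectedComponentIn ({S}ᶜ : Set (BerkP1 K)) u ⊆ A :=
        BerkAux.subset_of_sep hsep isPreconnected_connectedComponentIn
          (mem_connectedComponentIn huS) huA
          (fun hc => connectedComponentIn_subset _ _ hc rfl)
      exact Set.disjoint_left.mp hAB (h2 h1) hvB
  · exfalso
    have key : ∀ W : Set (BerkP1 K), S ∈ frontier W → (W ∩ A).Nonempty := by
      intro W hW
      rw [Set.inter_comm]
      exact mem_closure_iff.mp (frontier_subset_closure hW) A hsep.1 hSA
    have h1 := BerkAux.mem_of_sep hsep hUc.isPreconnected hu huA (key U hSU)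
    have h2 := BerkAux.mem_of_sep hsep hVc.isPreconnected hv hvA (key V hSV)
    have h3 : t ∈ U ∩ V := ⟨h1, h2⟩
    rw [hdisj] at h3
    exact h3
end
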